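/- arXiv:1402.3142 — 5 statements merged into one kernel-verified Lean document; each statement's English description precedes it below -/
import Mathlib

section
/- Every p-path degenerate finite simple graph G admits a graph homomorphism to any odd cycle of length at most p + 1; in particular, χ_c(G) ≤ 2 + 1/⌊p/2⌋. -/
open SimpleGraph ENNReal

universe u

/-- `H` is a shallow minor of `G` at depth `r`: there are pairwise disjoint branch sets
`A i ⊆ V(G)`, each inducing a connected subgraph of radius at most `r` (witnessed by a
center joined to every vertex of the branch set by a walk of length at most `r` inside it),
such that adjacency in `H` is witnessed by an edge of `G` between the branch sets. -/
def SimpleGraph.IsShallowMinor {V : Type u} (G : SimpleGraph V) (r : ℕ)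
    {h : ℕ} (H : SimpleGraph (Fin h)) : Prop :=
  ∃ A : Fin h → Set V,
    (Pairwise fun i j => Disjoint (A i) (A j)) ∧
    (∀ i, ∃ c : A i, ∀ v : A i, ∃ w : (G.induce (A i)).Walk c v, w.length ≤ r) ∧
    (∀ i j, H.Adj i j → ∃ a ∈ A i, ∃ b ∈ A j, G.Adj a b)

/-- The grad (greatest reduced average density) `∇_r(G)`: supremum of `‖H‖/|H|` over the
shallow minors `H` of `G` at depth `r`. -/
noncomputable def SimpleGraph.nabla {V : Type u} (G : SimpleGraph V) (r : ℕ) : ℝ≥0∞ :=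
  sSup {x : ℝ≥0∞ | ∃ (h : ℕ) (H : SimpleGraph (Fin h)), 0 < h ∧ G.IsShallowMinor r H ∧
    x = (Nat.card H.edgeSet : ℝ≥0∞) / (h : ℝ≥0∞)}

/-- A class of finite simple graphs, presented as a set of graphs on `Fin n` for varying `n`. -/
abbrev GraphClass : Type := Set ((n : ℕ) × SimpleGraph (Fin n))

/-- The expansion `Ex_C(r) = sup { ∇_r(G) : G ∈ C }` of a class of graphs. -/
noncomputable def GraphClass.expansion (C : GraphClass) (r : ℕ) : ℝ≥0∞ :=
  sSup {x : ℝ≥0∞ | ∃ G ∈ C, x = SimpleGraph.nabla G.2 r}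

/-- Iterated deletion of internal vertices of long induced-degree-two paths, ending in a
forest.  `PathDegen G p H` means the subgraph `H` of `G` can be reduced to a forest by
repeatedly deleting the internal vertices (all of degree two) of a path of length at
least `p`. -/
inductive SimpleGraph.PathDegen {V : Type u} (G : SimpleGraph V) (p : ℕ) : G.Subgraph → Prop
  | forest (H : G.Subgraph) (hH : H.coe.IsAcyclic) : PathDegen G p H
  | step (H : G.Subgraph) (l : List V) (hnd : l.Nodup)
      (hchain : l.Chain' H.Adj) (hlen : p + 1 ≤ l.length)
      (hdeg : ∀ v ∈ l.tail.dropLast, (H.neighborSet v).ncard = 2)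
      (hrec : PathDegen G p (H.deleteVerts {v | v ∈ l.tail.dropLast})) :
      PathDegen G p H

/-- A graph is `p`-path degenerate if it can be reduced to a forest by repeatedly deleting
the internal vertices, all of degree two, of paths of length at least `p`. -/
def SimpleGraph.IsPathDegenerate {V : Type u} (G : SimpleGraph V) (p : ℕ) : Prop :=
  G.PathDegen p ⊤

/-- A circular `(n,k)`-coloring: a map to `ℤ_n` sending adjacent vertices to elements at
circular distance at least `k`. -/
def SimpleGraph.IsCircularColoring {V : Type u} (G : SimpleGraph V) (n k : ℕ) : Prop :=
  ∃ f : V → ZMod n, ∀ u v, G.Adj u v → k ≤ (f u - f v).val ∧ (f u - f v).val ≤ n - k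

/-- The circular chromatic number: the infimum of the rationals `n/k` such that `G` has a
circular `(n,k)`-coloring. -/
noncomputable def SimpleGraph.circChromNum {V : Type u} (G : SimpleGraph V) : ℝ :=
  sInf {x : ℝ | ∃ n k : ℕ, 0 < n ∧ 0 < k ∧ G.IsCircularColoring n k ∧ x = (n : ℝ) / (k : ℝ)}

/-- `o` is an orientation of `G`: every arc of `o` is an edge of `G`, and every edge of `G`
gets exactly one of its two possible directions. -/
def SimpleGraph.IsOrientation {V : Type u} (G : SimpleGraph V) (o : V → V → Prop) : Prop :=
  (∀ u v, o u v → G.Adj u v) ∧ (∀ u v, G.Adj u v → (o u v ↔ ¬ o v u))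

/-- The oriented chromatic number: the least `k` such that every orientation of `G` admits a
homomorphism into some loopless digraph on `k` vertices. -/
noncomputable def SimpleGraph.orientedChromNum {V : Type u} (G : SimpleGraph V) : ℕ :=
  sInf {k : ℕ | ∀ o : V → V → Prop, G.IsOrientation o →
    ∃ D : Fin k → Fin k → Prop, Irreflexive D ∧
      ∃ f : V → Fin k, ∀ u v, o u v → D (f u) (f v)}

/-- The circulant digraph `C⃗_n^d`: vertex set `ℤ_n`, with an arc `(i,j)` whenever
`j - i ∈ {1, …, d}` (mod `n`). -/
def circulantDigraph (n d : ℕ) : ZMod n → ZMod n → Prop :=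
  fun i j => ∃ s : ℕ, 1 ≤ s ∧ s ≤ d ∧ j - i = (s : ZMod n)

/-- Tree-depth of `G`: the minimum height of a rooted forest (encoded as a strict partial
order on the vertices in which the set of strict ancestors of any vertex is a chain) all of
whose chains have at most `k` vertices, such that every edge of `G` joins two comparable
vertices. -/
noncomputable def SimpleGraph.treeDepth {V : Type u} [Fintype V] (G : SimpleGraph V) : ℕ :=
  sInf {k : ℕ | ∃ lt : V → V → Prop, Transitive lt ∧ Irreflexive lt ∧
    (∀ x y z, lt x z → lt y z → (lt x y ∨ lt y x ∨ x = y)) ∧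
    (∀ u v, G.Adj u v → lt u v ∨ lt v u) ∧
    (∀ s : Finset V, (∀ x ∈ s, ∀ y ∈ s, x = y ∨ lt x y ∨ lt y x) → s.card ≤ k)}

/-- The `p`-th chromatic number `χ_p(G)`: the least `N` such that `G` has a vertex coloring
with `N` colors in which, for every `i ≤ p`, the union of any `i` color classes induces a
subgraph of tree-depth at most `i`. -/
noncomputable def SimpleGraph.chiP {V : Type u} [Fintype V] (G : SimpleGraph V) (p : ℕ) : ℕ :=
  sInf {N : ℕ | ∃ c : V → Fin N, ∀ i : ℕ, i ≤ p → ∀ s : Finset (Fin N), s.card = i →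
    (G.induce {v | c v ∈ s}).treeDepth ≤ i}

/-- A `p`-centered coloring: every connected induced subgraph either has a color appearing
exactly once in it, or receives at least `p` distinct colors. -/
def SimpleGraph.IsCenteredColoring {V : Type u} (G : SimpleGraph V) (p : ℕ)
    {N : ℕ} (c : V → Fin N) : Prop :=
  ∀ s : Set V, (G.induce s).Connected →
    (∃ col : Fin N, {v ∈ s | c v = col}.ncard = 1) ∨ p ≤ (c '' s).ncard

/-- `H` is a minor of `G`: there are pairwise disjoint branch sets, each inducing a
connected subgraph of `G`, such that adjacency in `H` is witnessed by an edge of `G`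
between the corresponding branch sets. -/
def SimpleGraph.IsMinor {V : Type u} (G : SimpleGraph V) {h : ℕ} (H : SimpleGraph (Fin h)) : Prop :=
  ∃ A : Fin h → Set V,
    (Pairwise fun i j => Disjoint (A i) (A j)) ∧
    (∀ i, (G.induce (A i)).Connected) ∧
    (∀ i j, H.Adj i j → ∃ a ∈ A i, ∃ b ∈ A j, G.Adj a b)

/-- A minor-closed class of graphs. -/
def GraphClass.MinorClosed (C : GraphClass) : Prop :=
  ∀ G ∈ C, ∀ (h : ℕ) (H : SimpleGraph (Fin h)), (Sigma.snd G).IsMinor H → ⟨h, H⟩ ∈ C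

/-- The clique-grad `ω_r(G)`: the maximum clique number over the shallow minors of `G`
at depth `r`. -/
noncomputable def SimpleGraph.omegaMinor {V : Type u} (G : SimpleGraph V) (r : ℕ) : ℕ :=
  sSup {k : ℕ | ∃ (h : ℕ) (H : SimpleGraph (Fin h)), G.IsShallowMinor r H ∧
    ∃ s : Finset (Fin h), H.IsNClique k s}

/-- In `ℤ_{2m+1}` any two elements are joined by a walk of any prescribed length at least `2m`
in the Cayley graph generated by `±1`. -/
theorem ZMod.exists_unit_step_walk (m L : ℕ) (hL : 2 * m ≤ L) (a b : ZMod (2 * m + 1)) :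
    ∃ c : ℕ → ZMod (2 * m + 1), c 0 = a ∧ c L = b ∧
      ∀ i, c i - c (i + 1) = 1 ∨ c (i + 1) - c i = 1 := by
  obtain ⟨r, hrL, hcast⟩ : ∃ r ≤ L, (r : ZMod (2 * m + 1)) =
      (b - a + (L : ZMod (2 * m + 1))) * ((m : ZMod (2 * m + 1)) + 1) := by
    refine ⟨ZMod.val _, ?_, ZMod.natCast_zmod_val _⟩
    exact (Nat.lt_succ_iff.1 (ZMod.val_lt _)).trans hL
  have hN : (2 * m + 1 : ZMod (2 * m + 1)) = 0 := by
    exact_mod_cast ZMod.natCast_self (2 * m + 1)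
  refine ⟨fun i => a + 2 * ((min i r : ℕ) : ZMod (2 * m + 1)) - i, by simp, ?_, fun i => ?_⟩
  · simp only [min_eq_right hrL, hcast]
    linear_combination (b - a + (L : ZMod (2 * m + 1))) * hN
  · rcases lt_or_ge i r with h | h
    · right
      simp only [min_eq_left h.le, min_eq_left (Nat.succ_le_of_lt h)]
      push_cast
      ring
    · left
      simp only [min_eq_right h, min_eq_right (h.trans i.le_succ)]
      push_cast
      ring

theorem List.mem_tail_dropLast_iff {α : Type*} {l : List α} {v : α} :
    v ∈ l.tail.dropLast ↔ ∃ (i : ℕ) (h : i + 2 < l.length), l[i + 1] = v := by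
  rw [List.mem_iff_getElem]
  constructor
  · rintro ⟨i, h, rfl⟩
    have h' : i < l.length - 1 - 1 := by simpa using h
    exact ⟨i, by omega, by simp⟩
  · rintro ⟨i, h, rfl⟩
    exact ⟨i, by simp; omega, by simp⟩

theorem SimpleGraph.PathDegen.exists_unit_step_map {V : Type u} [Finite V] {G : SimpleGraph V}
    {p m : ℕ} (hm : 2 * m ≤ p) {H : G.Subgraph} (h : G.PathDegen p H) :
    ∃ f : V → ZMod (2 * m + 1), ∀ u v, H.Adj u v → f u - f v = 1 ∨ f v - f u = 1 := by
  classical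
  induction h with
  | forest H hH =>
    obtain ⟨C⟩ := hH.colorable_two
    refine ⟨fun v => if hv : v ∈ H.verts then ((C ⟨v, hv⟩ : ℕ) : ZMod (2 * m + 1)) else 0,
      fun u v huv => ?_⟩
    have hu := H.edge_vert huv
    have hv := H.edge_vert huv.symm
    have hne : C ⟨u, hu⟩ ≠ C ⟨v, hv⟩ := C.valid (by simpa using huv)
    simp only [hu, hv, dif_pos]
    generalize C ⟨u, hu⟩ = x at hne
    generalize C ⟨v, hv⟩ = y at hne
    fin_cases x <;> fin_cases y <;> simp at hne ⊢
  | step H l hnd hchain hlen hdeg _ ih =>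
    obtain ⟨f, hf⟩ := ih
    replace hchain : l.IsChain H.Adj := hchain
    rw [List.isChain_iff_getElem] at hchain
    obtain ⟨c, hc0, hcL, hc⟩ := ZMod.exists_unit_step_walk m (l.length - 1) (by omega)
      (f l[0]) (f l[l.length - 1])
    set g : V → ZMod (2 * m + 1) := fun v =>
      if v ∈ l.tail.dropLast then c (l.idxOf v) else f v with hg
    have hgl : ∀ (i : ℕ) (hi : i < l.length), g l[i] = c i := by
      intro i hi
      by_cases hmem : l[i] ∈ l.tail.dropLast
      · simp only [hg, if_pos hmem, hnd.idxOf_getElem]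
      · simp only [hg, if_neg hmem]
        have : i = 0 ∨ i = l.length - 1 := by
          by_contra! hcon
          refine hmem (List.mem_tail_dropLast_iff.2 ⟨i - 1, by omega, ?_⟩)
          congr 1
          omega
        rcases this with rfl | rfl
        · exact hc0.symm
        · exact hcL.symm
    have key : ∀ u v, u ∈ l.tail.dropLast → H.Adj u v → g u - g v = 1 ∨ g v - g u = 1 := by
      intro u v hu huv
      have hcard := hdeg u hu
      obtain ⟨i, hi, rfl⟩ := List.mem_tail_dropLast_iff.1 hu
      have hne : l[i] ≠ l[i + 2] := by
        rw [Ne, hnd.getElem_inj_iff]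
        omega
      have hsub : {l[i], l[i + 2]} ⊆ H.neighborSet l[i + 1] := by
        rintro x (rfl | rfl)
        · exact (hchain i (by omega)).symm
        · exact hchain (i + 1) (by omega)
      have heq := Set.eq_of_subset_of_ncard_le hsub (by rw [hcard, Set.ncard_pair hne])
      have hv : v ∈ ({l[i], l[i + 2]} : Set V) := heq ▸ huv
      rcases hv with rfl | rfl
      · rw [hgl, hgl]
        exact (hc i).symm
      · rw [hgl, hgl]
        exact hc (i + 1)
    refine ⟨g, fun u v huv => ?_⟩
    by_cases hu : u ∈ l.tail.dropLast
    · exact key u v hu huv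
    by_cases hv : v ∈ l.tail.dropLast
    · exact (key v u hv huv.symm).symm
    simp only [hg, if_neg hu, if_neg hv]
    exact hf u v (Subgraph.deleteVerts_adj.2
      ⟨H.edge_vert huv, hu, H.edge_vert huv.symm, hv, huv⟩)

theorem SimpleGraph.circChromNum_le {V : Type u} {G : SimpleGraph V} {n k : ℕ} (hn : 0 < n)
    (hk : 0 < k) (h : G.IsCircularColoring n k) : G.circChromNum ≤ n / k := by
  refine csInf_le ⟨0, ?_⟩ ⟨n, k, hn, hk, h, rfl⟩
  rintro x ⟨a, b, -, -, -, rfl⟩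
  positivity

theorem SimpleGraph.isCircularColoring_of_unit_step_map {V : Type u} {G : SimpleGraph V} {m : ℕ}
    (f : V → ZMod (2 * m + 1)) (hf : ∀ u v, G.Adj u v → f u - f v = 1 ∨ f v - f u = 1) :
    G.IsCircularColoring (2 * m + 1) m := by
  have hN : (2 * m + 1 : ZMod (2 * m + 1)) = 0 := by
    exact_mod_cast ZMod.natCast_self (2 * m + 1)
  refine ⟨fun v => m * f v, fun u v huv => ?_⟩
  rcases hf u v huv with h | h
  · have : (m * f u - m * f v : ZMod (2 * m + 1)) = (m : ℕ) := by
      linear_combination (m : ZMod (2 * m + 1)) * h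
    rw [this, ZMod.val_natCast_of_lt (by omega)]
    omega
  · have : (m * f u - m * f v : ZMod (2 * m + 1)) = (m + 1 : ℕ) := by
      push_cast
      linear_combination -(m : ZMod (2 * m + 1)) * h - hN
    by_cases hm : m = 0
    · subst hm
      simp
    rw [this, ZMod.val_natCast_of_lt (by omega)]
    omega

theorem path_degenerate_hom_to_odd_cycle
    {V : Type} [Fintype V] (G : SimpleGraph V) (p : ℕ) (hp : 2 ≤ p)
    (h : G.IsPathDegenerate p) :
    (∀ m : ℕ, 1 ≤ m → 2 * m + 1 ≤ p + 1 → Nonempty (G →g cycleGraph (2 * m + 1))) ∧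
    G.circChromNum ≤ 2 + 1 / ((p / 2 : ℕ) : ℝ) := by
  refine ⟨fun m hm hmp => ?_, ?_⟩
  · obtain ⟨f, hf⟩ := SimpleGraph.PathDegen.exists_unit_step_map (m := m) (by omega) h
    obtain ⟨k, rfl⟩ := Nat.exists_eq_add_of_le' hm
    exact ⟨⟨f, fun {u v} huv => cycleGraph_adj.2 (hf u v huv)⟩⟩
  · obtain ⟨f, hf⟩ := SimpleGraph.PathDegen.exists_unit_step_map (m := p / 2) (by omega) h
    have hpos : 0 < p / 2 := by omega
    refine (circChromNum_le (Nat.succ_pos _) hpos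
      (isCircularColoring_of_unit_step_map f hf)).trans_eq ?_
    have : ((p / 2 : ℕ) : ℝ) ≠ 0 := by exact_mod_cast hpos.ne'
    push_cast at this ⊢
    field_simp
end

section
/- Let n, d be positive integers with d ≥ 2 and n > d. For every oriented path P⃗ of length at least (n − 1)/(d − 1) and every pair (u, v) of (not necessarily distinct) vertices of the circulant digraph C⃗_n^d, there is a digraph homomorphism from P⃗ to C⃗_n^d mapping the two end-vertices of P⃗ to u and v respectively. -/
open SimpleGraph ENNReal

universe u

/-- A walk in `C⃗_n^d` following the directions `e` whose total displacement after `k` steps is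
that of the extreme walk (forward steps `1`, backward steps `-d`) plus `min t (k * (d - 1))`. -/
def circulantWalk (n d t : ℕ) (e : ℕ → Bool) (u : ZMod n) (k : ℕ) : ZMod n :=
  u + ∑ i ∈ Finset.range k, (if e i then (1 : ZMod n) else -(d : ZMod n)) +
    (min t (k * (d - 1)) : ℕ)

theorem circulantWalk_step {d : ℕ} (hd : 1 ≤ d) (n t : ℕ) (e : ℕ → Bool) (u : ZMod n) (k : ℕ) :
    if e k then circulantDigraph n d (circulantWalk n d t e u k) (circulantWalk n d t e u (k + 1))
    else circulantDigraph n d (circulantWalk n d t e u (k + 1)) (circulantWalk n d t e u k) := by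
  obtain ⟨a, had, ha⟩ : ∃ a ≤ d - 1, min t ((k + 1) * (d - 1)) = min t (k * (d - 1)) + a := by
    refine ⟨min t ((k + 1) * (d - 1)) - min t (k * (d - 1)), ?_, ?_⟩ <;>
      rw [add_mul, one_mul] <;> omega
  split_ifs with h
  · refine ⟨1 + a, by omega, by omega, ?_⟩
    simp only [circulantWalk, Finset.sum_range_succ, ha, h, if_true]
    push_cast
    ring
  · refine ⟨d - a, by omega, by omega, ?_⟩
    rw [Nat.cast_sub (by omega)]
    simp only [circulantWalk, Finset.sum_range_succ, ha, h]
    push_cast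
    ring

theorem nesetril_raspaud_sopena
    (n d : ℕ) (hd : 2 ≤ d) (hn : d < n) (L : ℕ)
    (hL : ((n : ℝ) - 1) / ((d : ℝ) - 1) ≤ (L : ℝ))
    (ε : Fin L → Bool) (u v : ZMod n) :
    ∃ f : Fin (L + 1) → ZMod n, f 0 = u ∧ f (Fin.last L) = v ∧
      ∀ i : Fin L,
        if ε i then circulantDigraph n d (f i.castSucc) (f i.succ)
        else circulantDigraph n d (f i.succ) (f i.castSucc) := by
  have : NeZero n := ⟨by omega⟩
  have hnL : n - 1 ≤ L * (d - 1) := by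
    have hd' : (0 : ℝ) < (d : ℝ) - 1 := by
      have : (2 : ℝ) ≤ d := by exact_mod_cast hd
      linarith
    rw [div_le_iff₀ hd'] at hL
    rw [← Nat.cast_le (α := ℝ), Nat.cast_mul, Nat.cast_pred (by omega), Nat.cast_pred (by omega)]
    exact hL
  let e : ℕ → Bool := fun i => if h : i < L then ε ⟨i, h⟩ else true
  let t : ℕ :=
    (v - u - ∑ i ∈ Finset.range L, (if e i then (1 : ZMod n) else -(d : ZMod n))).val
  have ht : t ≤ L * (d - 1) := (Nat.le_sub_one_of_lt (ZMod.val_lt _)).trans hnL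
  refine ⟨fun k => circulantWalk n d t e u k, by simp [circulantWalk], ?_, fun i => ?_⟩
  · simp only [circulantWalk, Fin.val_last, min_eq_left ht]
    rw [ZMod.natCast_zmod_val]
    ring
  · have hi : e i = ε i := dif_pos i.isLt
    simpa only [hi, Fin.val_castSucc, Fin.val_succ] using
      circulantWalk_step (by omega) n t e u i
end

section
/- For every rational number r ≥ 2 and every positive integer l, there exists a finite simple graph G with girth at least l and circular chromatic number χ_c(G) = r. -/
open SimpleGraph ENNReal

universe u

open Finset in
open scoped Classical in
theorem SimpleGraph.card_walk_length_le {V : Type*} [Fintype V] (G : SimpleGraph V) {D : ℕ}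
    (hD : ∀ v, G.degree v ≤ D) (a : V) (k : ℕ) :
    #{b | ∃ w : G.Walk a b, w.length ≤ k} ≤ (D + 1) ^ k := by
  induction k with
  | zero =>
    rw [pow_zero, Finset.card_le_one]
    simp only [Finset.mem_filter, Finset.mem_univ, true_and]
    rintro b ⟨w, hw⟩ c ⟨w', hw'⟩
    rw [← Walk.eq_of_length_eq_zero (Nat.le_zero.1 hw),
      ← Walk.eq_of_length_eq_zero (Nat.le_zero.1 hw')]
  | succ k ih =>
    have hsub : ({b | ∃ w : G.Walk a b, w.length ≤ k + 1} : Finset V) ⊆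
        ({b | ∃ w : G.Walk a b, w.length ≤ k} : Finset V).biUnion
          fun x => insert x (G.neighborFinset x) := by
      intro b hb
      simp only [Finset.mem_filter, Finset.mem_univ, true_and] at hb
      simp only [Finset.mem_biUnion, Finset.mem_filter, Finset.mem_univ, true_and,
        Finset.mem_insert, mem_neighborFinset]
      obtain ⟨w, hw⟩ := hb
      rcases Nat.lt_or_ge k w.length with h | h
      · obtain ⟨c, q, hc, hq⟩ : ∃ c, ∃ q : G.Walk a c, G.Adj c b ∧ q.length ≤ k := by
          cases hr : w.reverse with
          | nil =>
            have := congrArg Walk.length hr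
            rw [Walk.length_reverse, Walk.length_nil] at this
            omega
          | cons h' p =>
            have := congrArg Walk.length hr
            rw [Walk.length_reverse, Walk.length_cons] at this
            exact ⟨_, p.reverse, h'.symm, by rw [Walk.length_reverse]; omega⟩
        exact ⟨c, ⟨q, hq⟩, Or.inr hc⟩
      · exact ⟨b, ⟨w, h⟩, Or.inl rfl⟩
    calc _ ≤ _ := card_le_card hsub
      _ ≤ #({b | ∃ w : G.Walk a b, w.length ≤ k} : Finset V) * (D + 1) := by
        refine card_biUnion_le_card_mul _ _ _ fun x _ => (card_insert_le _ _).trans ?_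
        rw [card_neighborFinset_eq_degree]
        exact Nat.succ_le_succ (hD x)
      _ ≤ _ := by rw [pow_succ]; exact Nat.mul_le_mul_right _ ih

theorem SimpleGraph.le_length_of_isCycle_sup_edge {V : Type*} {G : SimpleGraph V} {l : ℕ}
    (hG : ∀ (v : V) (w : G.Walk v v), w.IsCycle → l ≤ w.length) {a b : V}
    (hab : ∀ w : G.Walk a b, l < w.length) {v : V} (w : (G ⊔ edge a b).Walk v v)
    (hw : w.IsCycle) : l ≤ w.length := by
  classical
  have mem_old : ∀ {e}, e ∈ (G ⊔ edge a b).edgeSet → e ≠ s(a, b) → e ∈ G.edgeSet := by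
    intro e
    induction e with
    | _ x y =>
      simp only [mem_edgeSet, sup_adj, edge_adj, ne_eq, Sym2.eq_iff]
      tauto
  by_cases he : s(a, b) ∈ w.edges
  · have ha := w.fst_mem_support_of_mem_edges he
    set c := w.rotate a ha with hc
    have hcl : c.length = w.length := w.length_rotate _ ha
    have hbc : b ∈ c.support := (w.mem_support_rotate_iff _ ha).2 (w.snd_mem_support_of_mem_edges he)
    have hnd : c.edges.Nodup := (hw.rotate ha).edges_nodup
    have hspec := c.take_spec hbc
    rw [← hspec, Walk.edges_append, List.nodup_append] at hnd
    have hlen := congrArg Walk.length hspec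
    rw [Walk.length_append] at hlen
    by_cases h1 : s(a, b) ∈ (c.takeUntil b hbc).edges
    · have h2 : s(a, b) ∉ (c.dropUntil b hbc).edges := fun h2 => hnd.2.2 _ h1 _ h2 rfl
      have := hab ((c.dropUntil b hbc).transfer G fun e he' =>
        mem_old (Walk.edges_subset_edgeSet _ he') (fun h => h2 (h ▸ he'))).reverse
      simp only [Walk.length_reverse, Walk.length_transfer] at this
      omega
    · have := hab ((c.takeUntil b hbc).transfer G fun e he' =>
        mem_old (Walk.edges_subset_edgeSet _ he') (fun h => h1 (h ▸ he')))
      simp only [Walk.length_transfer] at this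
      omega
  · have h : ∀ e ∈ w.edges, e ∈ G.edgeSet := fun e he' =>
      mem_old (Walk.edges_subset_edgeSet _ he') (fun h => he (h ▸ he'))
    simpa using hG v (w.transfer G h) (hw.transfer h)

theorem SimpleGraph.degree_sup_edge_le {V : Type*} [Fintype V] [DecidableEq V] (G : SimpleGraph V)
    (a b v : V) [DecidableRel G.Adj] {_ : DecidableRel (G ⊔ edge a b).Adj} :
    (G ⊔ edge a b).degree v ≤ G.degree v + (if v = a then 1 else 0) + if v = b then 1 else 0 := by
  have hsub : (G ⊔ edge a b).neighborFinset v ⊆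
      G.neighborFinset v ∪ (if v = a then {b} else ∅) ∪ if v = b then {a} else ∅ := by
    intro x
    simp only [mem_neighborFinset, sup_adj, edge_adj, Finset.mem_union]
    rintro (h | ⟨⟨rfl, rfl⟩ | ⟨rfl, rfl⟩, -⟩) <;> simp [*]
  rw [← card_neighborFinset_eq_degree, ← card_neighborFinset_eq_degree]
  refine (Finset.card_le_card hsub).trans ((Finset.card_union_le _ _).trans ?_)
  refine add_le_add ((Finset.card_union_le _ _).trans (add_le_add le_rfl ?_)) ?_
  all_goals split_ifs <;> simp

theorem SimpleGraph.sum_degree_sup_edge_le {V : Type*} [Fintype V] [DecidableEq V]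
    (G : SimpleGraph V) (a b : V) [DecidableRel G.Adj] {_ : DecidableRel (G ⊔ edge a b).Adj} :
    ∑ v, (G ⊔ edge a b).degree v ≤ ∑ v, G.degree v + 2 :=
  calc _ ≤ ∑ v, (G.degree v + (if v = a then 1 else 0) + if v = b then 1 else 0) :=
        Finset.sum_le_sum fun v _ => G.degree_sup_edge_le a b v
    _ = _ := by simp [Finset.sum_add_distrib]

open Finset in
open scoped Classical in
/-- In a sparse graph of bounded degree, some pair of distant vertices of small degree lies in a
positive proportion of the products `A ×ˢ B` of pairs of large sets. -/
theorem SimpleGraph.exists_distant_pair_hits {V : Type*} [Fintype V] (G : SimpleGraph V)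
    {K T l : ℕ} (hK : 0 < K) (hT : 0 < T)
    (hsum : ∑ v, G.degree v ≤ 2 * (T * Fintype.card V))
    (hdeg : ∀ v, G.degree v ≤ 16 * K ^ 2 * T)
    (hV : 4 * K ^ 2 * (16 * K ^ 2 * T + 1) ^ l ≤ Fintype.card V)
    (U : Finset (Finset V × Finset V)) (hne : U.Nonempty)
    (hU : ∀ x ∈ U, Fintype.card V ≤ K * #x.1 ∧ Fintype.card V ≤ K * #x.2) :
    ∃ a b, (∀ w : G.Walk a b, l < w.length) ∧ G.degree a < 16 * K ^ 2 * T ∧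
      G.degree b < 16 * K ^ 2 * T ∧ #U ≤ 2 * K ^ 2 * #{x ∈ U | a ∈ x.1 ∧ b ∈ x.2} := by
  set n := Fintype.card V with hn
  set D := 16 * K ^ 2 * T with hD
  have hn0 : 0 < n := lt_of_lt_of_le (by positivity) hV
  let P : Finset (V × V) := {x | (∀ w : G.Walk x.1 x.2, l < w.length) ∧
    G.degree x.1 < D ∧ G.degree x.2 < D}
  let sat : Finset V := {v | D ≤ G.degree v}
  let near : Finset (V × V) := {x | ∃ w : G.Walk x.1 x.2, w.length ≤ l}
  have hnear : 4 * K ^ 2 * #near ≤ n ^ 2 := by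
    have h1 : #near ≤ n * (D + 1) ^ l := by
      have h2 : near ⊆ (univ : Finset V).biUnion fun a =>
          ({b | ∃ w : G.Walk a b, w.length ≤ l} : Finset V).image (Prod.mk a) := by
        rintro ⟨a, b⟩ h
        simpa [near] using h
      refine (card_le_card h2).trans (card_biUnion_le_card_mul _ _ _ fun a _ => ?_)
      exact card_image_le.trans (G.card_walk_length_le hdeg a l)
    calc 4 * K ^ 2 * #near ≤ 4 * K ^ 2 * (n * (D + 1) ^ l) := Nat.mul_le_mul_left _ h1
      _ = n * (4 * K ^ 2 * (D + 1) ^ l) := by ring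
      _ ≤ n * n := Nat.mul_le_mul_left _ hV
      _ = n ^ 2 := by ring
  have hsat : 8 * K ^ 2 * #sat ≤ n := by
    have h1 : #sat * D ≤ 2 * (T * n) := by
      calc #sat * D = ∑ v ∈ sat, D := by simp
        _ ≤ ∑ v ∈ sat, G.degree v := sum_le_sum fun v hv => by simpa [sat] using hv
        _ ≤ ∑ v, G.degree v := sum_le_sum_of_subset (subset_univ _)
        _ ≤ _ := hsum
    have h2 : (2 * T) * (8 * K ^ 2 * #sat) ≤ (2 * T) * n := by
      calc (2 * T) * (8 * K ^ 2 * #sat) = #sat * D := by rw [hD]; ring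
        _ ≤ _ := h1
        _ = _ := by ring
    exact Nat.le_of_mul_le_mul_left h2 (by positivity)
  have hPc : 2 * K ^ 2 * #Pᶜ ≤ n ^ 2 := by
    have h1 : Pᶜ ⊆ near ∪ (sat ×ˢ univ ∪ univ ×ˢ sat) := by
      rintro ⟨a, b⟩ h
      simp only [P, near, sat, mem_compl, mem_filter, mem_univ, true_and, mem_union, mem_product,
        and_true] at h ⊢
      by_contra! h'
      exact h ⟨h'.1, h'.2.1, h'.2.2⟩
    have h2 : #Pᶜ ≤ #near + (#sat * n + n * #sat) := by
      refine (card_le_card h1).trans ((card_union_le _ _).trans (add_le_add le_rfl ?_))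
      refine (card_union_le _ _).trans ?_
      rw [card_product, card_product, card_univ]
    nlinarith [Nat.mul_le_mul_left n hsat]
  have hhit : ∀ x ∈ U, n ^ 2 ≤ 2 * K ^ 2 * #{y ∈ P | y.1 ∈ x.1 ∧ y.2 ∈ x.2} := by
    intro x hx
    have h1 : x.1 ×ˢ x.2 ⊆ ({y ∈ P | y.1 ∈ x.1 ∧ y.2 ∈ x.2} : Finset (V × V)) ∪ Pᶜ := by
      rintro y hy
      rw [mem_product] at hy
      by_cases h : y ∈ P <;> simp [h, hy]
    have h2 := (card_le_card h1).trans (card_union_le _ _)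
    rw [card_product] at h2
    have h3 := Nat.mul_le_mul (hU x hx).1 (hU x hx).2
    nlinarith
  have hPne : P.Nonempty := by
    obtain ⟨x, hx⟩ := hne
    have h1 : 0 < #{y ∈ P | y.1 ∈ x.1 ∧ y.2 ∈ x.2} := by
      by_contra! h
      have := hhit x hx
      rw [Nat.le_zero.1 h, mul_zero] at this
      exact absurd this (not_le.2 (pow_pos hn0 2))
    obtain ⟨y, hy⟩ := card_pos.1 h1
    exact ⟨y, (mem_filter.1 hy).1⟩
  have hPn : #P ≤ n ^ 2 := by
    refine (card_le_univ P).trans ?_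
    rw [Fintype.card_prod, sq]
  have hcount : ∑ y ∈ P, #{x ∈ U | y.1 ∈ x.1 ∧ y.2 ∈ x.2} =
      ∑ x ∈ U, #{y ∈ P | y.1 ∈ x.1 ∧ y.2 ∈ x.2} :=
    sum_card_bipartiteAbove_eq_sum_card_bipartiteBelow
      fun (y : V × V) (x : Finset V × Finset V) => y.1 ∈ x.1 ∧ y.2 ∈ x.2
  obtain ⟨y, hy, hle⟩ : ∃ y ∈ P, #U ≤ 2 * K ^ 2 * #{x ∈ U | y.1 ∈ x.1 ∧ y.2 ∈ x.2} := by
    refine exists_le_of_sum_le hPne ?_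
    rw [← mul_sum, hcount, mul_sum, sum_const, smul_eq_mul]
    calc #P * #U ≤ n ^ 2 * #U := Nat.mul_le_mul_right _ hPn
      _ = ∑ x ∈ U, n ^ 2 := by rw [sum_const, smul_eq_mul, mul_comm]
      _ ≤ _ := sum_le_sum hhit
  obtain ⟨h1, h2, h3⟩ := (mem_filter.1 hy).2
  exact ⟨y.1, y.2, h1, h2, h3, hle⟩

open Finset in
open scoped Classical in
/-- Graphs of large girth in which any two sets of linear size are joined by an edge. -/
theorem SimpleGraph.exists_girth_forall_exists_adj (K l : ℕ) (hK : 0 < K) :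
    ∃ n₀ : ℕ, ∀ (V : Type) [Fintype V], n₀ ≤ Fintype.card V → ∃ G : SimpleGraph V,
      (l : ℕ∞) ≤ G.egirth ∧ ∀ A B : Finset V, Fintype.card V ≤ K * #A → Fintype.card V ≤ K * #B →
        ∃ a ∈ A, ∃ b ∈ B, G.Adj a b := by
  set L := 2 * K ^ 2 with hL
  have hL1 : 1 ≤ L := Nat.succ_le_of_lt (by positivity)
  obtain ⟨T, hTL⟩ : ∃ T : ℕ, (L - 1) ^ T * 4 < L ^ T := by
    have hLpos : (0 : ℝ) < L := by exact_mod_cast hL1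
    obtain ⟨T, hT⟩ := exists_pow_lt_of_lt_one (show (0 : ℝ) < 1 / 4 by norm_num)
      (show ((L - 1 : ℕ) : ℝ) / L < 1 by
        rw [div_lt_one hLpos]; exact_mod_cast Nat.sub_lt hL1 one_pos)
    refine ⟨T, ?_⟩
    rw [div_pow, div_lt_div_iff₀ (by positivity) (by norm_num), one_mul] at hT
    exact_mod_cast hT
  have hT : 0 < T := by
    rcases Nat.eq_zero_or_pos T with rfl | h
    · simp at hTL
    · exact h
  set D := 16 * K ^ 2 * T with hD
  refine ⟨4 * K ^ 2 * (D + 1) ^ l, fun V _ hV => ?_⟩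
  set n := Fintype.card V with hn
  have hn0 : 0 < n := lt_of_lt_of_le (by positivity) hV
  let U : SimpleGraph V → Finset (Finset V × Finset V) := fun G =>
    {x | n ≤ K * #x.1 ∧ n ≤ K * #x.2 ∧ ∀ a ∈ x.1, ∀ b ∈ x.2, ¬ G.Adj a b}
  have key : ∀ t ≤ T * n, ∃ G : SimpleGraph V,
      (∀ (v : V) (w : G.Walk v v), w.IsCycle → l ≤ w.length) ∧ (∀ v, G.degree v ≤ D) ∧
      ∑ v, G.degree v ≤ 2 * t ∧ #(U G) * L ^ t ≤ (L - 1) ^ t * 4 ^ n := by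
    intro t
    induction t with
    | zero =>
      refine fun _ => ⟨⊥, ?_, by simp, by simp, ?_⟩
      · intro v w hw
        cases w with
        | nil => exact absurd rfl hw.ne_nil
        | cons h _ => exact h.elim
      · have := card_le_univ (U ⊥)
        rw [Fintype.card_prod, Fintype.card_finset, ← mul_pow] at this
        simpa using this
    | succ t ih =>
      intro ht
      obtain ⟨G, hcyc, hdeg, hsum, hcard⟩ := ih (by omega)
      rcases (U G).eq_empty_or_nonempty with hemp | hne
      · exact ⟨G, hcyc, hdeg, by omega, by simp [hemp]⟩
      obtain ⟨a, b, hab, ha, hb, hhit⟩ := G.exists_distant_pair_hits hK hT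
        (hsum.trans (Nat.mul_le_mul_left 2 ((Nat.le_succ t).trans ht))) hdeg hV
        (U G) hne fun x hx => by
          have := (mem_filter.1 hx).2
          exact ⟨this.1, this.2.1⟩
      have hne' : a ≠ b := by
        rintro rfl
        exact absurd (hab .nil) (by simp)
      refine ⟨G ⊔ edge a b, fun v w hw => le_length_of_isCycle_sup_edge hcyc hab w hw, fun v => ?_,
        ?_, ?_⟩
      · refine (G.degree_sup_edge_le a b v).trans ?_
        have := hdeg v
        by_cases h1 : v = a
        · subst h1
          simp only [if_true, if_neg hne']
          omega
        · by_cases h2 : v = b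
          · subst h2
            simp only [if_neg h1, if_true]
            omega
          · simpa [h1, h2] using this
      · exact (G.sum_degree_sup_edge_le a b).trans (by omega)
      · have hsub : U (G ⊔ edge a b) ⊆ (U G) \ ({x ∈ U G | a ∈ x.1 ∧ b ∈ x.2}) := by
          intro x hx
          simp only [U, mem_filter, mem_univ, true_and, mem_sdiff] at hx ⊢
          refine ⟨⟨hx.1, hx.2.1, fun c hc d hd h => hx.2.2 c hc d hd (Or.inl h)⟩, fun h => ?_⟩
          exact hx.2.2 a h.2.1 b h.2.2 (Or.inr (by simp [edge_adj, hne']))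
        have h1 := card_le_card hsub
        rw [card_sdiff_of_subset (filter_subset _ _)] at h1
        have h2 : #(U (G ⊔ edge a b)) * L ≤ #(U G) * (L - 1) := by
          have h3 := Nat.mul_le_mul_left L h1
          rw [Nat.mul_sub] at h3
          rw [Nat.mul_sub, mul_one, mul_comm]
          refine h3.trans ?_
          rw [mul_comm L]
          exact Nat.sub_le_sub_left hhit _
        calc #(U (G ⊔ edge a b)) * L ^ (t + 1) = #(U (G ⊔ edge a b)) * L * L ^ t := by ring
          _ ≤ #(U G) * (L - 1) * L ^ t := Nat.mul_le_mul_right _ h2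
          _ = (L - 1) * (#(U G) * L ^ t) := by ring
          _ ≤ (L - 1) * ((L - 1) ^ t * 4 ^ n) := Nat.mul_le_mul_left _ hcard
          _ = _ := by ring
  obtain ⟨G, hcyc, -, -, hcard⟩ := key _ le_rfl
  refine ⟨G, le_egirth.2 fun v w hw => by exact_mod_cast hcyc v w hw, fun A B hA hB => ?_⟩
  by_contra! h
  have hmem : (A, B) ∈ U G := by simpa [U] using ⟨hA, hB, h⟩
  have h1 : 1 ≤ #(U G) := card_pos.2 ⟨_, hmem⟩
  have h2 : L ^ (T * n) ≤ (L - 1) ^ (T * n) * 4 ^ n :=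
    (Nat.le_mul_of_pos_left _ h1).trans hcard
  rw [pow_mul, pow_mul, ← mul_pow] at h2
  exact absurd h2 (not_le.2 (Nat.pow_lt_pow_left hTL hn0.ne'))

open Finset in
theorem Finset.exists_median {α : Type*} (A : Finset α) (g : α → ℕ) :
    ∃ m, #A ≤ 2 * #{a ∈ A | g a ≤ m} ∧ #A ≤ 2 * #{a ∈ A | m ≤ g a} := by
  have hex : ∃ m, #A ≤ 2 * #{a ∈ A | g a ≤ m} := by
    refine ⟨A.sup g, ?_⟩
    rw [filter_true_of_mem fun a ha => le_sup ha]
    omega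
  classical
  refine ⟨Nat.find hex, Nat.find_spec hex, ?_⟩
  have hsplit := card_filter_add_card_filter_not (s := A) fun a => Nat.find hex ≤ g a
  rcases Nat.eq_zero_or_pos (Nat.find hex) with h0 | hpos
  · simp only [h0, zero_le, filter_true]
    omega
  · have h1 := Nat.find_min hex (Nat.sub_lt hpos one_pos)
    have h2 : ({a ∈ A | ¬ Nat.find hex ≤ g a} : Finset α) =
        {a ∈ A | g a ≤ Nat.find hex - 1} := filter_congr fun a _ => by omega
    rw [h2] at hsplit
    omega

theorem ZMod.val_natCast_sub_natCast {n a b : ℕ} (hba : b ≤ a) (ha : a < n) :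
    ((a : ZMod n) - (b : ZMod n)).val = a - b := by
  rw [← Nat.cast_sub hba, ZMod.val_natCast_of_lt (by omega)]

/-- Two residues at circular distance at least `k` modulo `n`. -/
def ZMod.CircFar {n : ℕ} (k : ℕ) (x y : ZMod n) : Prop :=
  k ≤ (x - y).val ∧ (x - y).val ≤ n - k

theorem ZMod.CircFar.symm {n k : ℕ} [NeZero n] (hk : 0 < k) {x y : ZMod n}
    (h : CircFar k x y) : CircFar k y x := by
  obtain ⟨h1, h2⟩ := h
  have h0 : NeZero (x - y) := ⟨fun h => by rw [h, ZMod.val_zero] at h1; omega⟩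
  have h3 := ZMod.val_neg_of_ne_zero (x - y)
  have h4 := ZMod.val_lt (x - y)
  rw [neg_sub] at h3
  constructor <;> omega

theorem ZMod.circFar_natCast {n k a b : ℕ} (ha : a < n) (hab : b ≤ a) :
    CircFar k (a : ZMod n) b ↔ k ≤ a - b ∧ a - b ≤ n - k := by
  rw [CircFar, val_natCast_sub_natCast hab ha]

open Finset in
theorem ZMod.card_le_of_not_circFar {p q : ℕ} [NeZero p] (hq : 0 < q) (hpq : 2 * q ≤ p)
    (S : Finset (ZMod p)) (hS : ∀ x ∈ S, ∀ y ∈ S, ¬ CircFar q x y) : #S ≤ q := by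
  rcases S.eq_empty_or_nonempty with rfl | ⟨s, hs⟩
  · simp
  let φ : ZMod p → ℕ := fun x => if (x - s).val < q then (x - s).val else (x - s).val - (p - q)
  have hfar : ∀ x ∈ S, q ≤ (x - s).val → p - q < (x - s).val := fun x hx h => by
    by_contra! h'
    exact hS x hx s hs ⟨h, h'⟩
  have hcross : ∀ x ∈ S, ∀ y ∈ S, (x - s).val ≠ (y - s).val + (p - q) := by
    intro x hx y hy h
    refine hS x hx y hy ?_
    have h1 : (x - y).val = (x - s).val - (y - s).val := by
      rw [← ZMod.val_sub (by omega), sub_sub_sub_cancel_right]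
    constructor <;> omega
  have hmaps : Set.MapsTo φ S (Finset.range q) := by
    intro x hx
    have h1 := hfar x hx
    have h2 := ZMod.val_lt (x - s)
    simp only [φ, coe_range, Set.mem_Iio]
    split_ifs <;> omega
  have hinj : Set.InjOn φ S := by
    intro x hx y hy hxy
    have h1 := hfar x hx
    have h2 := hfar y hy
    have h3 := hcross x hx y hy
    have h4 := hcross y hy x hx
    have h5 : (x - s).val = (y - s).val := by
      simp only [φ] at hxy
      split_ifs at hxy <;> omega
    exact sub_left_injective (ZMod.val_injective p h5)
  simpa using card_le_card_of_injOn φ hmaps hinj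

open Finset in
/-- A homomorphism between circular complete graphs does not decrease the ratio. -/
theorem ZMod.mul_le_mul_of_circFar_map {p q n k : ℕ} [NeZero p] [NeZero n] (hq : 0 < q)
    (hpq : 2 * q ≤ p) (hkn : k ≤ n) (hk : 0 < k) (f : ZMod p → ZMod n)
    (hf : ∀ x y, CircFar q x y → CircFar k (f x) (f y)) : p * k ≤ n * q := by
  have hS : ∀ t : ZMod n, #{x | (f x - t).val < k} ≤ q := by
    refine fun t => ZMod.card_le_of_not_circFar hq hpq _ fun x hx y hy hxy => ?_
    simp only [mem_filter, mem_univ, true_and] at hx hy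
    rcases le_total (f y - t).val (f x - t).val with h | h
    · have h1 := (hf x y hxy).1
      rw [← sub_sub_sub_cancel_right (f x) (f y) t, ZMod.val_sub h] at h1
      omega
    · have h1 := ((hf x y hxy).symm hk).1
      rw [← sub_sub_sub_cancel_right (f y) (f x) t, ZMod.val_sub h] at h1
      omega
  have hcard : ∀ x : ZMod n, k ≤ #{t | (x - t).val < k} := by
    intro x
    rw [← card_range k]
    refine card_le_card_of_injOn (fun i => x - (i : ZMod n)) ?_ ?_
    · intro i hi
      have hi : i < k := by simpa using hi
      simpa [ZMod.val_natCast_of_lt (show i < n by omega)] using hi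
    · intro i hi j hj hij
      have hi : i < k := by simpa using hi
      have hj : j < k := by simpa using hj
      have := congrArg ZMod.val (sub_right_injective hij)
      rwa [ZMod.val_natCast_of_lt (by omega), ZMod.val_natCast_of_lt (by omega)] at this
  calc p * k = ∑ _x : ZMod p, k := by simp [ZMod.card]
    _ ≤ ∑ x : ZMod p, #{t | (f x - t).val < k} := sum_le_sum fun x _ => hcard (f x)
    _ = ∑ t : ZMod n, #{x | (f x - t).val < k} :=
      sum_card_bipartiteAbove_eq_sum_card_bipartiteBelow
        fun (x : ZMod p) (t : ZMod n) => (f x - t).val < k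
    _ ≤ ∑ _t : ZMod n, q := sum_le_sum fun t _ => hS t
    _ = n * q := by simp [ZMod.card]

open Finset in
/-- If every fibre of `π` is large and large sets are joined by edges of `Γ`, then any circular
coloring with few color arcs of the pullback of `R` inside `Γ` descends along `π`,
by taking a median color in each fibre. -/
theorem SimpleGraph.exists_circFar_of_fibers {V ι : Type*} [Fintype V] (Γ : SimpleGraph V)
    (π : V → ι) (R : ι → ι → Prop) {M K n k : ℕ} [NeZero n] (hk : 0 < k) (hn : n ≤ M * k)
    [DecidableEq ι]
    (hπ : ∀ i, 2 * M * Fintype.card V ≤ K * #{v | π v = i})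
    (hV : 0 < Fintype.card V) (hM : 0 < M)
    (hΓ : ∀ A B : Finset V, Fintype.card V ≤ K * #A → Fintype.card V ≤ K * #B →
      ∃ a ∈ A, ∃ b ∈ B, Γ.Adj a b)
    (f : V → ZMod n)
    (hf : ∀ u v, Γ.Adj u v → R (π u) (π v) → ZMod.CircFar k (f u) (f v)) :
    ∃ g : ι → ZMod n, ∀ i j, R i j → ZMod.CircFar k (g i) (g j) := by
  have hclass : ∀ i, ∃ c, #{v | π v = i} ≤ M * #{v | π v = i ∧ (f v).val / k = c} := by
    intro i
    obtain ⟨c, -, hc⟩ := exists_le_of_sum_le (s := range M)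
      (f := fun _ => #{v | π v = i})
      (g := fun c => M * #{v | π v = i ∧ (f v).val / k = c}) ⟨0, mem_range.2 hM⟩ (by
        rw [sum_const, smul_eq_mul, card_range, ← mul_sum]
        refine Nat.mul_le_mul_left _ (le_of_eq ?_)
        rw [card_eq_sum_card_fiberwise (f := fun v => (f v).val / k) (t := range M)]
        · simp only [filter_filter]
        · intro v _
          simp only [coe_range, Set.mem_Iio]
          exact Nat.div_lt_of_lt_mul (by
            have := ZMod.val_lt (f v)
            rw [mul_comm]
            omega))
    exact ⟨c, hc⟩
  choose c hc using hclass
  let A : ι → Finset V := fun i => {v | π v = i ∧ (f v).val / k = c i}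
  have hmed := fun i => (A i).exists_median fun v => (f v).val
  choose m hlow hupp using hmed
  have hbig : ∀ i (B : Finset V), #(A i) ≤ 2 * #B → Fintype.card V ≤ K * #B := by
    intro i B hB
    have h1 : 2 * M * Fintype.card V ≤ 2 * M * (K * #B) := by
      calc 2 * M * Fintype.card V ≤ K * #{v | π v = i} := hπ i
        _ ≤ K * (M * #(A i)) := Nat.mul_le_mul_left _ (hc i)
        _ ≤ K * (M * (2 * #B)) := by gcongr
        _ = _ := by ring
    exact Nat.le_of_mul_le_mul_left h1 (by positivity)
  have hmem : ∀ {i v}, v ∈ A i → π v = i ∧ (f v).val / k = c i := fun hv => by simpa [A] using hv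
  have hnonempty : ∀ i (B : Finset V), #(A i) ≤ 2 * #B → B.Nonempty := by
    intro i B hB
    rw [← card_pos]
    by_contra! h
    have := hbig i B hB
    rw [Nat.le_zero.1 h] at this
    omega
  have hmc : ∀ i, m i / k = c i ∧ m i < n := by
    intro i
    obtain ⟨u, hu⟩ := hnonempty i _ (hlow i)
    obtain ⟨v, hv⟩ := hnonempty i _ (hupp i)
    rw [mem_filter] at hu hv
    refine ⟨le_antisymm ?_ ?_, hv.2.trans_lt (ZMod.val_lt _)⟩
    · rw [← (hmem hv.1).2]; exact Nat.div_le_div_right hv.2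
    · rw [← (hmem hu.1).2]; exact Nat.div_le_div_right hu.2
  have hdist : ∀ {i j u v}, R i j ∨ R j i → u ∈ A i → v ∈ A j → Γ.Adj u v →
      (f v).val ≤ (f u).val → k ≤ (f u).val - (f v).val ∧ (f u).val - (f v).val ≤ n - k := by
    intro i j u v hij hu hv huv hle
    have hfar : ZMod.CircFar k (f u) (f v) := by
      rcases hij with h | h
      · exact hf u v huv (by rwa [(hmem hu).1, (hmem hv).1])
      · exact (hf v u huv.symm (by rwa [(hmem hu).1, (hmem hv).1])).symm hk
    rwa [ZMod.CircFar, ZMod.val_sub hle] at hfar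
  have hmain : ∀ i j, R i j ∨ R j i → m j ≤ m i → k ≤ m i - m j ∧ m i - m j ≤ n - k := by
    intro i j hij hle
    obtain ⟨u, hu, v, hv, huv⟩ := hΓ _ _ (hbig i _ (hlow i)) (hbig j _ (hupp j))
    obtain ⟨u', hu', v', hv', huv'⟩ := hΓ _ _ (hbig i _ (hupp i)) (hbig j _ (hlow j))
    rw [mem_filter] at hu hv hu' hv'
    have hcle : c j ≤ c i := by
      rw [← (hmc i).1, ← (hmc j).1]; exact Nat.div_le_div_right hle
    have hcne : c j ≠ c i := by
      intro h
      have h1 := (hmem hu.1).2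
      have h2 := (hmem hv.1).2
      rw [h, ← h1] at h2
      have h3 := Nat.div_add_mod (f u).val k
      have h4 := Nat.div_add_mod (f v).val k
      have h5 := Nat.mod_lt (f u).val hk
      have h6 := Nat.mod_lt (f v).val hk
      rw [h2] at h4
      rcases le_total (f v).val (f u).val with h7 | h7
      · have := hdist hij hu.1 hv.1 huv h7
        omega
      · have := hdist hij.symm hv.1 hu.1 huv.symm h7
        omega
    have hlt : ∀ {x y}, x ∈ A i → y ∈ A j → (f y).val ≤ (f x).val := by
      intro x y hx hy
      by_contra! h
      have := Nat.div_le_div_right (c := k) h.le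
      rw [(hmem hx).2, (hmem hy).2] at this
      omega
    have h1 := hdist hij hu.1 hv.1 huv (hlt hu.1 hv.1)
    have h2 := hdist hij hu'.1 hv'.1 huv' (hlt hu'.1 hv'.1)
    have h3 := hlt hu.1 hv.1
    omega
  refine ⟨fun i => (m i : ZMod n), fun i j hij => ?_⟩
  rcases le_total (m j) (m i) with h | h
  · exact (ZMod.circFar_natCast (hmc i).2 h).2 (hmain i j (Or.inl hij) h)
  · exact ((ZMod.circFar_natCast (hmc j).2 h).2 (hmain j i (Or.inr hij) h)).symm hk

theorem nesetril_zhu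
    (r : ℚ) (hr : 2 ≤ r) (l : ℕ) (hl : 0 < l) :
    ∃ (m : ℕ) (G : SimpleGraph (Fin m)),
      (l : ℕ∞) ≤ G.egirth ∧ G.circChromNum = (r : ℝ) := by
  classical
  obtain ⟨p, hp⟩ : ∃ p : ℕ, r.num = p := Int.eq_ofNat_of_zero_le (Rat.num_nonneg.2 (by linarith))
  set q := r.den with hq
  have hq0 : 0 < q := r.den_pos
  have hrpq : (r : ℝ) = p / q := by
    rw [Rat.cast_def, hp, hq, Int.cast_natCast]
  have hpq : 2 * q ≤ p := by
    have h1 : (2 : ℝ) ≤ p / q := by rw [← hrpq]; exact_mod_cast hr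
    rw [le_div_iff₀ (by exact_mod_cast hq0)] at h1
    exact_mod_cast h1
  have hp0 : 0 < p := by omega
  have : NeZero p := ⟨hp0.ne'⟩
  obtain ⟨n₀, hn₀⟩ := exists_girth_forall_exists_adj (2 * p * p) l (by positivity)
  set N := n₀ + 1 with hN
  obtain ⟨Γ, hgirth, hΓ⟩ := hn₀ (Fin (p * N)) (by
    rw [Fintype.card_fin]; exact (Nat.le_succ n₀).trans (Nat.le_mul_of_pos_left _ hp0))
  let e : Fin (p * N) ≃ ZMod p × Fin N :=
    (Fintype.equivFinOfCardEq (by simp [ZMod.card])).symm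
  let π : Fin (p * N) → ZMod p := fun v => (e v).1
  have hπ : ∀ i, N ≤ Finset.card {v | π v = i} := by
    intro i
    calc N = (Finset.univ.image fun a : Fin N => e.symm (i, a)).card := by
          rw [Finset.card_image_of_injective, Finset.card_univ, Fintype.card_fin]
          intro a b hab
          simpa using hab
      _ ≤ _ := by
          refine Finset.card_le_card fun v hv => ?_
          obtain ⟨a, -, rfl⟩ := Finset.mem_image.1 hv
          simp [π]
  let G : SimpleGraph (Fin (p * N)) :=
    { Adj := fun u v => Γ.Adj u v ∧ ZMod.CircFar q (π u) (π v)
      symm := ⟨fun u v h => ⟨h.1.symm, h.2.symm hq0⟩⟩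
      loopless := ⟨fun u h => Γ.loopless.irrefl u h.1⟩ }
  refine ⟨p * N, G, hgirth.trans (egirth_anti fun u v h => h.1), ?_⟩
  rw [hrpq]
  refine le_antisymm (csInf_le ⟨0, ?_⟩ ⟨p, q, hp0, hq0, ⟨π, fun u v h => h.2⟩, rfl⟩)
    (le_csInf ⟨_, p, q, hp0, hq0, ⟨π, fun u v h => h.2⟩, rfl⟩ ?_)
  · rintro _ ⟨n, k, -, -, -, rfl⟩
    positivity
  rintro _ ⟨n, k, hn, hk, ⟨f, hf⟩, rfl⟩
  have : NeZero n := ⟨hn.ne'⟩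
  rw [div_le_div_iff₀ (by exact_mod_cast hq0) (by exact_mod_cast hk)]
  by_contra! hlt
  have hlt : n * q < p * k := by exact_mod_cast hlt
  have hnpk : n ≤ p * k := (Nat.le_mul_of_pos_right n hq0).trans hlt.le
  obtain ⟨g, hg⟩ := Γ.exists_circFar_of_fibers π (ZMod.CircFar q) (K := 2 * p * p) hk hnpk
    (fun i => by
      rw [Fintype.card_fin]
      calc 2 * p * (p * N) = 2 * p * p * N := by ring
        _ ≤ _ := Nat.mul_le_mul_left _ (hπ i))
    (by rw [Fintype.card_fin]; positivity) hp0 hΓ f fun u v huv h => hf u v ⟨huv, h⟩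
  have hkn : k ≤ n := by
    have h0 : ZMod.CircFar q ((q : ℕ) : ZMod p) ((0 : ℕ) : ZMod p) :=
      (ZMod.circFar_natCast (by omega) (Nat.zero_le _)).2 (by omega)
    have h1 := (hg _ _ h0).1
    have h2 := ZMod.val_lt (g ((q : ℕ) : ZMod p) - g ((0 : ℕ) : ZMod p))
    omega
  exact absurd (ZMod.mul_le_mul_of_circFar_map hq0 hpq hkn hk g hg) (not_le.2 hlt)
end

section
/- For every positive integer g, there exists a finite 3-regular simple graph G with girth at least g and circular chromatic number χ_c(G) ≥ 7/3. -/
open SimpleGraph ENNReal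

universe u

namespace CycleType

open Finset

lemma sum_zmod_seven (f : ZMod 7 → ℝ) : ∑ c, f c = f 0 + f 1 + f 2 + f 3 + f 4 + f 5 + f 6 :=
  Fin.sum_univ_seven f

/-- A Wirtinger-type inequality on the cycle of length seven. -/
lemma wirtinger_seven (x : ZMod 7 → ℝ) :
    ∑ c, x c * x (c + 1) ≤ 2 / 3 * ∑ c, x c ^ 2 + (∑ c, x c) ^ 2 / 21 := by
  simp only [sum_zmod_seven]
  change x 0 * x 1 + x 1 * x 2 + x 2 * x 3 + x 3 * x 4 + x 4 * x 5 + x 5 * x 6 + x 6 * x 0 ≤ _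
  generalize x 0 = a, x 1 = b, x 2 = c, x 3 = d, x 4 = e, x 5 = f, x 6 = g
  linear_combination 5 / 7 * sq_nonneg (a - 19 / 30 * b + 1 / 15 * (c + d + e + f) - 19 / 30 * g) +
    77 / 180 * sq_nonneg (b - 76 / 77 * c + 2 / 11 * (d + e + f) - 43 / 77 * g) +
    68 / 231 * sq_nonneg (c - 175 / 136 * d + 7 / 17 * (e + f) - 73 / 136 * g) +
    57 / 272 * sq_nonneg (d - 256 / 171 * e + 8 / 9 * f - 67 / 171 * g) +
    91 / 513 * sq_nonneg (e - 19 / 14 * f + 5 / 14 * g) + 13 / 84 * sq_nonneg (f - g)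

lemma tangent_bracket {w W : ℝ} (hw : 0 < w) (hw1 : w < 1) (hW : 0 < W) (hW1 : W < 1) :
    0 ≤ 5 * (2 * w + W) + (w + W) ^ 2 * (2 * w ^ 2 + 4 * W ^ 2 - 8) := by
  obtain ⟨s, rfl⟩ : ∃ s, W = s - w := ⟨w + W, by ring⟩
  have hs : 0 < s := by linarith
  rcases le_total s 0.85 with h | h
  · have h3 : s ^ 3 ≤ 0.85 ^ 3 := by gcongr
    have h4 : 0 ≤ 5 + 4 * s ^ 3 - 8 * s := by nlinarith [sq_nonneg (s - 0.8)]
    nlinarith [mul_nonneg hs.le h4, mul_nonneg hw.le (by linarith : 0 ≤ 5 - 8 * s ^ 3),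
      mul_pos (pow_pos hs 2) (pow_pos hw 2)]
  · have hq : 0 ≤ 32 * s ^ 6 - 192 * s ^ 4 + 200 * s ^ 3 - 25 := by
      have h2 : s ≤ 2 := by linarith
      obtain ⟨t, rfl⟩ : ∃ t, s = t + 0.85 := ⟨s - 0.85, by ring⟩
      have ht : 0 ≤ t := by linarith
      nlinarith [mul_nonneg ht (sq_nonneg (t - 0.3)), sq_nonneg (t - 0.3), sq_nonneg (t ^ 2 - 0.1), mul_nonneg ht (sq_nonneg (t ^ 2 - 0.1)), sq_nonneg (t ^ 3 - 0.1), sq_nonneg (t^3-t), sq_nonneg (t^2-0.3*t),mul_nonneg ht (sq_nonneg (t ^ 2 - 0.3*t)) ]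
    have := sq_nonneg (12 * s ^ 2 * w + 5 - 8 * s ^ 3)
    have : 0 ≤ (24 * s ^ 2) * (5 * (2 * w + (s - w)) +
        (w + (s - w)) ^ 2 * (2 * w ^ 2 + 4 * (s - w) ^ 2 - 8)) := by
      linear_combination this + hq
    exact nonneg_of_mul_nonneg_right this (by positivity)

lemma tangent_bracket' {w W : ℝ} (hw : 0 < w) (hw1 : w < 1) (hW : 0 < W) (hW1 : W < 1) :
    0 ≤ 3 * (2 * w + W) + (w + W) ^ 2 * (6 * w ^ 2 + 12 * W ^ 2 - 8) := by
  obtain ⟨s, rfl⟩ : ∃ s, W = s - w := ⟨w + W, by ring⟩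
  have hs : 0 < s := by linarith
  rcases le_total s 0.5 with h | h
  · have h3 : s ^ 3 ≤ 0.5 ^ 3 := by gcongr
    have h4 : 0 ≤ 3 + 12 * s ^ 3 - 8 * s := by nlinarith [sq_nonneg (s - 0.47)]
    nlinarith [mul_nonneg hs.le h4, mul_nonneg hw.le (by linarith : 0 ≤ 3 - 24 * s ^ 3),
      mul_pos (pow_pos hs 2) (pow_pos hw 2)]
  · have hq : 0 ≤ 288 * s ^ 6 - 576 * s ^ 4 + 360 * s ^ 3 - 9 := by
      have h2 : s ≤ 2 := by linarith
      obtain ⟨t, rfl⟩ : ∃ t, s = t + 0.5 := ⟨s - 0.5, by ring⟩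
      have ht : 0 ≤ t := by linarith
      nlinarith [mul_nonneg ht (sq_nonneg (t - 0.3)), sq_nonneg (t - 0.3), sq_nonneg (t ^ 2 - 0.1), mul_nonneg ht (sq_nonneg (t ^ 2 - 0.1)), sq_nonneg (t ^ 3 - 0.1), sq_nonneg (t^3-t), sq_nonneg (t^2-0.3*t),mul_nonneg ht (sq_nonneg (t ^ 2 - 0.3*t)) ]
    have := sq_nonneg (36 * s ^ 2 * w + 3 - 24 * s ^ 3)
    have : 0 ≤ (72 * s ^ 2) * (3 * (2 * w + (s - w)) +
        (w + (s - w)) ^ 2 * (6 * w ^ 2 + 12 * (s - w) ^ 2 - 8)) := by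
      linear_combination this + hq
    exact nonneg_of_mul_nonneg_right this (by positivity)

lemma seven_profile {W : ℝ} (h1 : 0.618 ≤ W) (h2 : W ≤ 0.858) :
    1 / 7 < 5 / 2 * W ^ 3 + 1 / 2 * W ^ 6 - 3 * W ^ 4 := by
  obtain ⟨t, rfl⟩ : ∃ t, W = t + 0.618 := ⟨W - 0.618, by ring⟩
  have ht : 0 ≤ t := by linarith
  have ht2 : 0 ≤ 0.24 - t := by linarith
  nlinarith [mul_nonneg ht ht2, mul_nonneg (mul_nonneg ht ht2) ht2, mul_nonneg (mul_nonneg ht ht2) ht, pow_nonneg ht 5, pow_nonneg ht 6, pow_nonneg ht 4, mul_nonneg (mul_nonneg (mul_nonneg ht ht2) ht) ht]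

theorem seven_cycle_bound (w : ZMod 7 → ℝ) (hpos : ∀ c, 0 < w c)
    (h1 : ∀ c, w (c + 1) ^ 2 < w c) (h2 : ∀ c, w (c - 1) ^ 2 + w (c + 1) ^ 2 = w c + w c ^ 4) :
    1 / 2 < ∑ c, w c ^ 2 * (w c - w (c + 1) ^ 2) := by
  have hlt : ∀ c, w c < 1 := by
    obtain ⟨m, hm⟩ := Finite.exists_max w
    have h := h1 (m - 1)
    rw [sub_add_cancel] at h
    have : w m < 1 := by nlinarith [hm (m - 1), hpos m]
    exact fun c => (hm c).trans_lt this
  set T := ∑ c, w c ^ 2 with hT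
  have hcard : (Finset.univ : Finset (ZMod 7)).card = 7 := by simp [ZMod.card]
  have hTpos : 0 < T := Finset.sum_pos (fun c _ => by have := hpos c; positivity) ⟨0, by simp⟩
  obtain ⟨W, hW, hWT⟩ : ∃ W : ℝ, 0 < W ∧ 7 * W ^ 2 = T :=
    ⟨Real.sqrt (T / 7), by positivity, by rw [Real.sq_sqrt (by positivity)]; ring⟩
  have hshift : ∀ f : ZMod 7 → ℝ, ∑ c, f (c + 1) = ∑ c, f c := fun f =>
    Equiv.sum_comp (Equiv.addRight (1 : ZMod 7)) f
  have hcross : 2 * ∑ c, w c ^ 2 * w (c + 1) ^ 2 = ∑ c, (w c ^ 3 + w c ^ 6) := by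
    have e : ∑ c, w (c - 1) ^ 2 * w c ^ 2 = ∑ c, w c ^ 2 * w (c + 1) ^ 2 := by
      rw [← hshift]; simp
    rw [two_mul]
    nth_rw 1 [← e]
    rw [← Finset.sum_add_distrib]
    refine Finset.sum_congr rfl fun c _ => ?_
    linear_combination w c ^ 2 * h2 c
  have hwir := wirtinger_seven fun c => w c ^ 2
  rw [← hT, ← hWT] at hwir
  have hWub : W ≤ 0.858 := by
    obtain ⟨m, hm⟩ := Finite.exists_min w
    have e1 := h2 m
    have e2 := hm (m - 1)
    have e3 := hm (m + 1)
    have e4 := hpos m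
    have e5 := hlt m
    have h6 : w m ^ 2 + w m ≤ 1 := by
      have : 0 ≤ w m * ((1 - w m) * (1 - w m - w m ^ 2)) := by nlinarith
      have := nonneg_of_mul_nonneg_right this e4
      have := nonneg_of_mul_nonneg_right this (by linarith)
      linarith
    have h7 : w m ≤ 0.6181 := by nlinarith
    have h8 : T ≤ w m ^ 2 + w (m - 1) ^ 2 + w (m + 1) ^ 2 + 4 := by
      rw [hT, ← Equiv.sum_comp (Equiv.addRight m)]
      rw [sum_zmod_seven]
      have a0 : (0 : ZMod 7) + m = m := zero_add m
      have a1 : (1 : ZMod 7) + m = m + 1 := add_comm _ _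
      have a6 : (6 : ZMod 7) + m = m - 1 := by rw [sub_eq_add_neg, add_comm]; rfl
      simp only [Equiv.coe_addRight]
      rw [a0, a1, a6]
      have b : ∀ c, w c ^ 2 ≤ 1 := fun c => pow_le_one₀ (hpos c).le (hlt c).le
      linarith [b ((2 : ZMod 7) + m), b ((3 : ZMod 7) + m), b ((4 : ZMod 7) + m),
        b ((5 : ZMod 7) + m)]
    have h9 : w m ^ 2 ≤ 0.6181 ^ 2 := by gcongr
    have h10 : w m ^ 4 ≤ 0.6181 ^ 4 := by gcongr
    nlinarith
  have hWlt : W < 1 := by linarith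
  have hlow : 0.618 ≤ W := by
    have key : ∀ c, 3 * W ^ 3 + 3 * W ^ 6 - 4 * W ^ 4 +
        (9 / 2 * W + 9 * W ^ 4 - 8 * W ^ 2) * (w c ^ 2 - W ^ 2) ≤
        3 * w c ^ 3 + 3 * w c ^ 6 - 4 * w c ^ 4 := fun c => by
      have := mul_nonneg (sq_nonneg (w c - W)) (tangent_bracket' (hpos c) (hlt c) hW hWlt)
      nlinarith
    have hs := Finset.sum_le_sum fun c (_ : c ∈ Finset.univ) => key c
    simp only [Finset.sum_add_distrib, Finset.sum_sub_distrib, ← Finset.mul_sum,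
      Finset.sum_const, hcard, ← hT, nsmul_eq_mul] at hs hcross
    have hsq : ∑ c, (w c ^ 2) ^ 2 = ∑ c, w c ^ 4 := Finset.sum_congr rfl fun c _ => by ring
    rw [hsq] at hwir
    rw [← hWT] at hs
    push_cast at hs
    have h3 : 0 ≤ W ^ 3 * (2 * W - 1 - W ^ 3) := by nlinarith
    have h4 := nonneg_of_mul_nonneg_right h3 (by positivity)
    have h5 : 0 ≤ (1 - W) * (W ^ 2 + W - 1) := by linear_combination h4
    have h6 := nonneg_of_mul_nonneg_right h5 (by linarith)
    nlinarith
  have key : ∀ c, 5 / 2 * W ^ 3 + 1 / 2 * W ^ 6 - 2 * W ^ 4 +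
      (15 / 4 * W + 3 / 2 * W ^ 4 - 4 * W ^ 2) * (w c ^ 2 - W ^ 2) ≤
      5 / 2 * w c ^ 3 + 1 / 2 * w c ^ 6 - 2 * w c ^ 4 := fun c => by
    have := mul_nonneg (sq_nonneg (w c - W)) (tangent_bracket (hpos c) (hlt c) hW hWlt)
    nlinarith
  have hs := Finset.sum_le_sum fun c (_ : c ∈ Finset.univ) => key c
  have hgoal : ∑ c, w c ^ 2 * (w c - w (c + 1) ^ 2) =
      ∑ c, w c ^ 3 - ∑ c, w c ^ 2 * w (c + 1) ^ 2 := by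
    rw [← Finset.sum_sub_distrib]
    exact Finset.sum_congr rfl fun c _ => by ring
  rw [hgoal]
  simp only [Finset.sum_add_distrib, Finset.sum_sub_distrib, ← Finset.mul_sum,
    Finset.sum_const, hcard, ← hT, nsmul_eq_mul] at hs hcross
  have hsq : ∑ c, (w c ^ 2) ^ 2 = ∑ c, w c ^ 4 := Finset.sum_congr rfl fun c _ => by ring
  rw [hsq] at hwir
  rw [← hWT] at hs
  push_cast at hs
  have := seven_profile hlow hWub
  nlinarith

/-- A colour of a half-edge: the colour of its end together with the direction (`true` for up)
in which the colour changes along the edge. -/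
abbrev Label : Type := ZMod 7 × Bool

/-- The local pictures at a vertex of a cubic graph: a colour and the directions of the three
half-edges, not all of them up. -/
abbrev VType : Type := {t : ZMod 7 × (Fin 3 → Bool) // ∃ i, t.2 i = false}

/-- The label of the `i`-th half-edge. -/
def label (τ : VType) (i : Fin 3) : Label := (τ.1.1, τ.1.2 i)

/-- The fraction of half-edges with a given label, for a distribution of the types. -/
noncomputable def marginal (ν : VType → ℝ) (l : Label) : ℝ :=
  1 / 3 * ∑ τ, ∑ i, if label τ i = l then ν τ else 0

/-- The difference between the fractions of the two labels that can be matched along an edge. -/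
noncomputable def imbalance (ν : VType → ℝ) (c : ZMod 7) : ℝ :=
  marginal ν (c, true) - marginal ν (c + 1, false)

/-- The exponential growth rate of matched configurations with type distribution `ν`. -/
noncomputable def rate (ν : VType → ℝ) : ℝ :=
  ∑ τ, Real.negMulLog (ν τ) - 3 / 2 * ∑ l, Real.negMulLog (marginal ν l)

/-- The equivalence of triples of directions with functions. -/
def tripleEquiv : Bool × Bool × Bool ≃ (Fin 3 → Bool) where
  toFun t := ![t.1, t.2.1, t.2.2]
  invFun D := (D 0, D 1, D 2)
  left_inv _ := rfl
  right_inv D := by ext i; fin_cases i <;> rfl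

lemma sum_vtype (F : ZMod 7 × (Fin 3 → Bool) → ℝ) :
    ∑ τ : VType, F τ.1 = ∑ c, (F (c, ![true, true, false]) + F (c, ![true, false, true]) +
      F (c, ![true, false, false]) + F (c, ![false, true, true]) + F (c, ![false, true, false]) +
      F (c, ![false, false, true]) + F (c, ![false, false, false])) := by
  rw [← sum_subtype (univ.filter fun t : ZMod 7 × (Fin 3 → Bool) => ∃ i, t.2 i = false) (by simp) F,
    sum_filter, Fintype.sum_prod_type]
  refine sum_congr rfl fun c _ => ?_
  rw [← tripleEquiv.sum_comp]
  simp [Fintype.sum_prod_type, show ∀ t, tripleEquiv t = ![t.1, t.2.1, t.2.2] from fun _ => rfl,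
    Fin.exists_fin_succ]
  try ring

lemma sum_label (F : Label → ℝ) : ∑ l, F l = ∑ c, (F (c, true) + F (c, false)) := by
  rw [Fintype.sum_prod_type]; simp

lemma marginal_nonneg {ν : VType → ℝ} (h : ∀ τ, 0 ≤ ν τ) (l) : 0 ≤ marginal ν l := by
  unfold marginal
  have : 0 ≤ ∑ τ, ∑ i, if label τ i = l then ν τ else 0 :=
    sum_nonneg fun τ _ => sum_nonneg fun i _ => by split_ifs <;> simp [h]
  positivity

lemma le_marginal {ν : VType → ℝ} (h : ∀ τ, 0 ≤ ν τ) (τ i) :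
    ν τ / 3 ≤ marginal ν (label τ i) := by
  unfold marginal
  have h1 : (∑ j, if label τ j = label τ i then ν τ else 0) ≤ 
      ∑ σ, ∑ j, if label σ j = label τ i then ν σ else 0 :=
    single_le_sum (f := fun σ => ∑ j, if label σ j = label τ i then ν σ else 0)
      (fun σ _ => sum_nonneg fun i _ => by split_ifs <;> simp [h]) (mem_univ τ)
  have h2 : ν τ ≤ ∑ j, if label τ j = label τ i then ν τ else 0 := by
    simpa using single_le_sum (f := fun j => if label τ j = label τ i then ν τ else 0)
      (fun σ _ => by split_ifs <;> simp [h]) (mem_univ i)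
  linarith

lemma sum_marginal (ν : VType → ℝ) (F : Label → ℝ) :
    ∑ l, marginal ν l * F l = 1 / 3 * ∑ τ, ν τ * ∑ i, F (label τ i) := by
  unfold marginal
  simp_rw [mul_assoc, ← mul_sum, sum_mul]
  rw [sum_comm]
  congr 1
  refine sum_congr rfl fun τ _ => ?_
  rw [sum_comm, mul_sum]
  exact sum_congr rfl fun i _ => by simp [ite_mul]

lemma marginal_add_smul (ν v : VType → ℝ) (t : ℝ) (l) :
    marginal (fun τ => ν τ + t * v τ) l = marginal ν l + t * marginal v l := by
  unfold marginal
  rw [mul_left_comm, ← mul_add]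
  congr 1
  rw [mul_sum, ← sum_add_distrib]
  refine sum_congr rfl fun τ _ => ?_
  rw [mul_sum, ← sum_add_distrib]
  exact sum_congr rfl fun i _ => by split_ifs <;> simp

lemma continuous_marginal (l) : Continuous fun ν => marginal ν l := by
  unfold marginal
  refine continuous_const.mul (continuous_finsetSum _ fun τ _ => continuous_finsetSum _ fun i _ => ?_)
  split_ifs <;> fun_prop

lemma continuous_rate : Continuous rate := by
  unfold rate
  refine (continuous_finsetSum _ fun τ _ => Real.continuous_negMulLog.comp (continuous_apply τ)).sub
    (continuous_const.mul (continuous_finsetSum _ fun l _ =>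
      Real.continuous_negMulLog.comp (continuous_marginal l)))


lemma marginal_true (G : ZMod 7 × (Fin 3 → Bool) → ℝ) (c : ZMod 7) :
    marginal (fun τ => G τ.1) (c, true) = 1 / 3 * (2 * G (c, ![true, true, false]) +
      2 * G (c, ![true, false, true]) + G (c, ![true, false, false]) +
      2 * G (c, ![false, true, true]) + G (c, ![false, true, false]) +
      G (c, ![false, false, true])) := by
  unfold marginal label
  rw [sum_vtype fun t => ∑ i, if (t.1, t.2 i) = (c, true) then G t else 0]
  simp [Fin.sum_univ_three, Finset.sum_add_distrib]
  ring

lemma marginal_false (G : ZMod 7 × (Fin 3 → Bool) → ℝ) (c : ZMod 7) :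
    marginal (fun τ => G τ.1) (c, false) = 1 / 3 * (G (c, ![true, true, false]) +
      G (c, ![true, false, true]) + 2 * G (c, ![true, false, false]) +
      G (c, ![false, true, true]) + 2 * G (c, ![false, true, false]) +
      2 * G (c, ![false, false, true]) + 3 * G (c, ![false, false, false])) := by
  unfold marginal label
  rw [sum_vtype fun t => ∑ i, if (t.1, t.2 i) = (c, false) then G t else 0]
  simp [Fin.sum_univ_three, Finset.sum_add_distrib]
  ring

lemma sum_label_shift (F : Label → ℝ) : ∑ l, F l = ∑ c, (F (c, true) + F (c + 1, false)) := by
  rw [sum_label, sum_add_distrib, sum_add_distrib,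
    ← Equiv.sum_comp (Equiv.addRight (1 : ZMod 7)) fun c => F (c, false)]
  rfl

lemma sum_marginal_one {ν : VType → ℝ} (h : ∑ τ, ν τ = 1) : ∑ l, marginal ν l = 1 := by
  have := sum_marginal ν fun _ => 1
  simp only [mul_one, sum_const, card_univ, Fintype.card_fin, nsmul_eq_mul, ← sum_mul, h] at this
  rw [this]; norm_num

lemma rate_neg_of_product {ν : VType → ℝ} {χ : Label → ℝ} {κ : ℝ} (hκ : 0 < κ)
    (hχ : ∀ l, 0 < χ l) (hν : ∀ τ, ν τ = κ * ∏ i, χ (label τ i)) (hsum : ∑ τ, ν τ = 1)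
    (ht : ∀ c, marginal ν (c, true) = χ (c, true) * χ (c + 1, false))
    (hf : ∀ c, marginal ν (c + 1, false) = χ (c, true) * χ (c + 1, false)) : rate ν < 0 := by
  have hν' : ν = fun τ : VType => (fun t : ZMod 7 × (Fin 3 → Bool) =>
      κ * ∏ i, χ (t.1, t.2 i)) τ.1 := by
    funext τ; exact hν τ
  have hm : ∑ l, Real.negMulLog (marginal ν l) = -2 * ∑ l, marginal ν l * Real.log (χ l) := by
    rw [sum_label_shift, sum_label_shift, mul_sum]
    refine sum_congr rfl fun c _ => ?_
    rw [ht, hf, Real.negMulLog, Real.log_mul (hχ _).ne' (hχ _).ne']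
    ring
  have hr : rate ν = -Real.log κ := by
    have : ∑ τ, Real.negMulLog (ν τ) = -Real.log κ - 3 * ∑ l, marginal ν l * Real.log (χ l) := by
      rw [sum_marginal, ← mul_assoc, mul_one_div_cancel (by norm_num), one_mul,
        ← mul_one (-Real.log κ), ← hsum, mul_sum, ← sum_sub_distrib]
      refine sum_congr rfl fun τ _ => ?_
      have : Real.log (ν τ) = Real.log κ + ∑ i, Real.log (χ (label τ i)) := by
        rw [hν, Real.log_mul hκ.ne' (prod_pos fun i _ => hχ _).ne',
          Real.log_prod fun i _ => (hχ _).ne']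
      rw [Real.negMulLog, this]; ring
    rw [rate, hm, this]; ring
  rw [hr, neg_lt_zero]
  by_contra hlog
  have hκ1 : κ ≤ 1 := by
    by_contra! h
    exact hlog (Real.log_pos h)
  have ez : ∀ c, χ (c + 1, false) =
      κ * ((χ (c, true) + χ (c, false)) ^ 2 - χ (c, true) ^ 2) := fun c => by
    have h := ht c
    rw [hν', marginal_true fun t => κ * ∏ i, χ (t.1, t.2 i)] at h
    simp [Fin.prod_univ_three] at h
    refine mul_left_cancel₀ (hχ (c, true)).ne' ?_
    rw [← h]; ring
  have ex : ∀ c, χ (c, true) = κ * (χ (c + 1, true) + χ (c + 1, false)) ^ 2 := fun c => by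
    have h := hf c
    rw [hν', marginal_false fun t => κ * ∏ i, χ (t.1, t.2 i)] at h
    simp [Fin.prod_univ_three] at h
    refine mul_left_cancel₀ (hχ (c + 1, false)).ne' ?_
    rw [mul_comm (χ (c + 1, false)), ← h]; ring
  set w : ZMod 7 → ℝ := fun c => κ * (χ (c + 1, true) + χ (c + 1, false)) with hw
  have hwpos : ∀ c, 0 < w c := fun c => mul_pos hκ (add_pos (hχ _) (hχ _))
  have hx : ∀ c, κ * χ (c, true) = w c ^ 2 := fun c => by rw [ex]; ring
  have hz : ∀ c, κ * χ (c + 1, false) = w c - w (c + 1) ^ 2 := fun c => by rw [← hx, hw]; ring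
  have := seven_cycle_bound w hwpos
    (fun c => by have := hz c; have := mul_pos hκ (hχ (c + 1, false)); linarith)
    (fun c => by
      have h1 := ez c
      have h2 := hz c
      have h3 := hx c
      have h4 : w (c - 1) = κ * (χ (c, true) + χ (c, false)) := by simp [hw]
      have h5 : w c ^ 4 = (κ * χ (c, true)) ^ 2 := by rw [h3]; ring
      rw [h5, h4]
      rw [h1] at h2
      linear_combination h2)
  have hs : ∑ c, w c ^ 2 * (w c - w (c + 1) ^ 2) = κ ^ 2 / 2 := by
    have h := sum_marginal_one hsum
    rw [sum_label_shift] at h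
    simp only [ht, hf, ← two_mul, ← mul_sum] at h
    simp_rw [← hz, ← hx]
    calc _ = κ ^ 2 * ∑ c, χ (c, true) * χ (c + 1, false) := by
          rw [mul_sum]; exact sum_congr rfl fun c _ => by ring
      _ = _ := by linear_combination κ ^ 2 / 2 * h
  rw [hs] at this
  nlinarith

lemma marginal_pos_of_balanced {ν : VType → ℝ} (h : ν ∈ stdSimplex ℝ VType)
    (hb : ∀ c, imbalance ν c = 0) (l) : 0 < marginal ν l := by
  have h0 := h.1
  have hdown : ∀ τ, 0 < ν τ → 0 < marginal ν (τ.1.1, false) := fun τ hτ => by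
    obtain ⟨i, hi⟩ := τ.2
    have := le_marginal h0 τ i
    rw [label, hi] at this
    linarith
  have htrue : ∀ c, marginal ν (c, true) = marginal ν (c + 1, false) := fun c => sub_eq_zero.1 (hb c)
  have hstep : ∀ c, 0 < marginal ν (c + 1, false) → 0 < marginal ν (c, false) := fun c hc => by
    rw [← htrue] at hc
    by_contra hcon
    have : ∀ τ : VType, ∀ i, (if label τ i = (c, true) then ν τ else 0) = 0 := fun τ i => by
      split_ifs with hl
      · by_contra hne
        have := hdown τ (lt_of_le_of_ne (h0 τ) (Ne.symm hne))
        have hc' : τ.1.1 = c := congrArg Prod.fst hl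
        rw [hc'] at this
        exact hcon this
      · rfl
    simp [marginal, this] at hc
  obtain ⟨τ, hτ⟩ : ∃ τ, 0 < ν τ := by
    by_contra! hcon
    have := h.2
    rw [sum_eq_zero fun τ _ => le_antisymm (hcon τ) (h0 τ)] at this
    exact zero_ne_one this
  have hall : ∀ n : ℕ, 0 < marginal ν (τ.1.1 - n, false) := fun n => by
    induction n with
    | zero => simpa using hdown τ hτ
    | succ n ih =>
      refine hstep _ ?_
      convert ih using 3
      push_cast
      ring
  have hall' : ∀ c, 0 < marginal ν (c, false) := fun c => by
    have := hall (τ.1.1 - c).val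
    rwa [ZMod.natCast_val, ZMod.cast_id, _root_.sub_sub_cancel] at this
  rcases l with ⟨c, _ | _⟩
  · exact hall' c
  · rw [htrue]; exact hall' _

/-- A balanced distribution with full support. -/
noncomputable def center (τ : VType) : ℝ :=
  if ∃ i, ∀ j, τ.1.2 j = false ↔ j = i then 1 / 35 else 1 / 70

lemma center_pos (τ) : 0 < center τ := by unfold center; split_ifs <;> norm_num

lemma sum_center : ∑ τ, center τ = 1 := by
  unfold center
  rw [sum_vtype fun t => if ∃ i, ∀ j, t.2 j = false ↔ j = i then 1 / 35 else 1 / 70]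
  simp [Fin.exists_fin_succ, Fin.forall_fin_succ]
  norm_num

lemma imbalance_center (c) : imbalance center c = 0 := by
  unfold imbalance center
  rw [marginal_true fun t => if ∃ i, ∀ j, t.2 j = false ↔ j = i then 1 / 35 else 1 / 70,
    marginal_false fun t => if ∃ i, ∀ j, t.2 j = false ↔ j = i then 1 / 35 else 1 / 70]
  simp [Fin.exists_fin_succ, Fin.forall_fin_succ]
  norm_num

lemma imbalance_add_smul (ν v : VType → ℝ) (t : ℝ) (c) :
    imbalance (fun τ => ν τ + t * v τ) c = imbalance ν c + t * imbalance v c := by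
  unfold imbalance
  rw [marginal_add_smul, marginal_add_smul]
  ring

lemma continuous_imbalance (c) : Continuous fun ν => imbalance ν c :=
  (continuous_marginal _).sub (continuous_marginal _)

lemma negMulLog_le_tangent {x y : ℝ} (hx : 0 < x) (hy : 0 ≤ y) :
    Real.negMulLog y ≤ Real.negMulLog x + (-Real.log x - 1) * (y - x) := by
  rcases hy.eq_or_lt with rfl | hy
  · simp [Real.negMulLog]; linarith
  · have := Real.log_le_sub_one_of_pos (div_pos hx hy)
    rw [Real.log_div hx.ne' hy.ne'] at this
    have := mul_le_mul_of_nonneg_left this hy.le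
    rw [mul_sub, mul_sub, mul_one, mul_div_cancel₀ _ hy.ne'] at this
    unfold Real.negMulLog
    linarith

lemma pos_of_isMaxOn {ν : VType → ℝ} (h : ν ∈ stdSimplex ℝ VType)
    (hb : ∀ c, imbalance ν c = 0)
    (hmax : ∀ μ ∈ stdSimplex ℝ VType, (∀ c, imbalance μ c = 0) → rate μ ≤ rate ν) (σ) :
    0 < ν σ := by
  by_contra hσ
  have hσ0 : ν σ = 0 := le_antisymm (not_lt.1 hσ) (h.1 σ)
  have hq := marginal_pos_of_balanced h hb
  set C := ∑ τ, (Real.negMulLog (center τ) - Real.negMulLog (ν τ)) -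
    3 / 2 * ∑ l, (-Real.log (marginal ν l) - 1) * (marginal center l - marginal ν l) with hC
  have key : ∀ t : ℝ, 0 < t → t < 1 → C + center σ * (-Real.log t) ≤ 0 := fun t ht ht1 => by
    set μ : VType → ℝ := fun τ => ν τ + t * (center τ - ν τ) with hμ
    have hμ' : ∀ τ, μ τ = (1 - t) * ν τ + t * center τ := fun τ => by rw [hμ]; ring
    have hμ0 : ∀ τ, 0 ≤ μ τ := fun τ => by
      rw [hμ']
      exact add_nonneg (mul_nonneg (by linarith) (h.1 τ)) (mul_nonneg ht.le (center_pos τ).le)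
    have hμS : μ ∈ stdSimplex ℝ VType := ⟨hμ0, by
      simp_rw [hμ', sum_add_distrib, ← mul_sum, sum_center, h.2]; ring⟩
    have hdiff : ∀ l, marginal (fun τ => center τ - ν τ) l = marginal center l - marginal ν l := by
      intro l
      have := marginal_add_smul center ν (-1) l
      simp only [neg_mul, one_mul, ← sub_eq_add_neg] at this
      exact this
    have hμb : ∀ c, imbalance μ c = 0 := fun c => by
      rw [hμ, imbalance_add_smul, hb, imbalance, hdiff, hdiff]
      have h1 := imbalance_center c
      have h2 := hb c
      unfold imbalance at h1 h2
      linear_combination t * h1 - t * h2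
    have hle := hmax μ hμS hμb
    have h1 : ∀ τ, (1 - t) * Real.negMulLog (ν τ) + t * Real.negMulLog (center τ) ≤
        Real.negMulLog (μ τ) := fun τ => by
      rw [hμ']
      exact Real.concaveOn_negMulLog.2 (h.1 τ) (center_pos τ).le (by linarith) ht.le (by ring)
    have h2 : Real.negMulLog (μ σ) = (1 - t) * Real.negMulLog (ν σ) +
        t * Real.negMulLog (center σ) + center σ * Real.negMulLog t := by
      rw [hμ', hσ0, mul_zero, zero_add, Real.negMulLog_mul]; simp; ring
    have h3 : ∑ τ, ((1 - t) * Real.negMulLog (ν τ) + t * Real.negMulLog (center τ)) +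
        center σ * Real.negMulLog t ≤ ∑ τ, Real.negMulLog (μ τ) := by
      rw [← add_sum_erase _ _ (mem_univ σ), ← add_sum_erase _ _ (mem_univ σ), h2]
      linarith [sum_le_sum fun τ (_ : τ ∈ univ.erase σ) => h1 τ]
    have h4 : ∑ l, Real.negMulLog (marginal μ l) ≤ ∑ l, (Real.negMulLog (marginal ν l) +
        (-Real.log (marginal ν l) - 1) * (t * (marginal center l - marginal ν l))) := by
      refine sum_le_sum fun l _ => ?_
      have := negMulLog_le_tangent (hq l) (marginal_nonneg hμ0 l)
      rw [hμ, marginal_add_smul, hdiff] at this ⊢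
      linarith
    have h5 : ∑ l, (Real.negMulLog (marginal ν l) +
        (-Real.log (marginal ν l) - 1) * (t * (marginal center l - marginal ν l))) =
        ∑ l, Real.negMulLog (marginal ν l) +
        t * ∑ l, (-Real.log (marginal ν l) - 1) * (marginal center l - marginal ν l) := by
      rw [sum_add_distrib, mul_sum]
      congr 1
      exact sum_congr rfl fun l _ => by ring
    have h6 : t * (C + center σ * (-Real.log t)) ≤ 0 := by
      rw [sum_add_distrib, ← mul_sum, ← mul_sum] at h3
      unfold rate at hle
      rw [hC, sum_sub_distrib]
      unfold Real.negMulLog at h3 ⊢ h4 h5 hle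
      linarith
    by_contra hcon
    exact absurd h6 (not_le.2 (mul_pos ht (not_le.1 hcon)))
  have hc := center_pos σ
  have := key (Real.exp (-(|C| / center σ + 1))) (Real.exp_pos _)
    (by rw [Real.exp_lt_one_iff]; have := div_nonneg (abs_nonneg C) hc.le; linarith)
  rw [Real.log_exp, neg_neg, mul_add, mul_div_cancel₀ _ hc.ne'] at this
  linarith [neg_abs_le C]

/-- The imbalance at a colour, as a linear functional. -/
noncomputable def imbalanceLin (c : ZMod 7) : (VType → ℝ) →ₗ[ℝ] ℝ where
  toFun v := imbalance v c
  map_add' u v := by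
    have := imbalance_add_smul u v 1 c
    simp only [one_mul] at this
    exact this
  map_smul' t v := by
    have h0 : imbalance 0 c = 0 := by simp [imbalance, marginal]
    have := imbalance_add_smul 0 v t c
    simp only [h0, Pi.zero_apply, zero_add] at this
    exact this

lemma marginal_single (τ : VType) (l : Label) :
    marginal (Pi.single τ 1) l = 1 / 3 * ∑ i, if label τ i = l then 1 else 0 := by
  unfold marginal
  congr 1
  rw [Fintype.sum_eq_single τ fun σ hσ => sum_eq_zero fun i _ => by simp [hσ]]
  simp

/-- The weight of a label in a linear combination of imbalances. -/
noncomputable def labelWeight (b : ZMod 7 → ℝ) (l : Label) : ℝ :=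
  (if l.2 then b l.1 else -b (l.1 - 1)) / 3

lemma sum_imbalance_single (b : ZMod 7 → ℝ) (τ : VType) :
    ∑ c, b c * imbalance (Pi.single τ 1) c =
      ∑ i, labelWeight b (label τ i) := by
  have h : ∀ c, b c * imbalance (Pi.single τ 1) c = ∑ i, b c / 3 *
      ((if label τ i = (c, true) then 1 else 0) - if label τ i = (c + 1, false) then 1 else 0) := by
    intro c
    rw [imbalance, marginal_single, marginal_single, ← mul_sum, sum_sub_distrib]
    ring
  simp_rw [h]
  rw [sum_comm]
  refine sum_congr rfl fun i _ => ?_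
  unfold label labelWeight
  cases τ.1.2 i
  · simp [Prod.ext_iff, ← sub_eq_iff_eq_add]
    ring
  · simp [Prod.ext_iff]

lemma rate_neg_of_isMaxOn {ν : VType → ℝ} (h : ν ∈ stdSimplex ℝ VType)
    (hb : ∀ c, imbalance ν c = 0)
    (hmax : ∀ μ ∈ stdSimplex ℝ VType, (∀ c, imbalance μ c = 0) → rate μ ≤ rate ν) :
    rate ν < 0 := by
  have hpos := pos_of_isMaxOn h hb hmax
  have hq := marginal_pos_of_balanced h hb
  set A : VType → ℝ := fun τ =>
    -Real.log (ν τ) + 1 / 2 * ∑ i, Real.log (marginal ν (label τ i)) with hA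
  have hstat : ∀ v : VType → ℝ, ∑ τ, v τ = 0 → (∀ c, imbalance v c = 0) → ∑ τ, v τ * A τ = 0 := by
    intro v hv hvb
    have hloc : IsLocalMax (fun t : ℝ => rate fun τ => ν τ + t * v τ) 0 := by
      have : ∀ᶠ t : ℝ in nhds 0, ∀ τ, 0 < ν τ + t * v τ := by
        rw [Filter.eventually_all]
        intro τ
        have hc : Continuous fun t : ℝ => ν τ + t * v τ := by fun_prop
        exact hc.continuousAt.eventually (lt_mem_nhds (by simpa using hpos τ))
      filter_upwards [this] with t ht
      have := hmax (fun τ => ν τ + t * v τ) ⟨fun τ => (ht τ).le, by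
        rw [sum_add_distrib, ← mul_sum, hv, h.2]; simp⟩ fun c => by
          rw [imbalance_add_smul, hb, hvb]; simp
      simpa using this
    have hline : ∀ a b : ℝ, 0 < a → HasDerivAt (fun t => Real.negMulLog (a + t * b))
        ((-Real.log a - 1) * b) 0 := fun a b ha => by
      have h1 : HasDerivAt (fun t : ℝ => a + t * b) b 0 := by
        simpa using ((hasDerivAt_id (0 : ℝ)).mul_const b).const_add a
      have h2 := Real.hasDerivAt_negMulLog ha.ne'
      exact HasDerivAt.comp (0 : ℝ) (by simpa using h2) h1
    have hder : HasDerivAt (fun t : ℝ => rate fun τ => ν τ + t * v τ)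
        (∑ τ, (-Real.log (ν τ) - 1) * v τ -
          3 / 2 * ∑ l, (-Real.log (marginal ν l) - 1) * marginal v l) 0 := by
      unfold rate
      simp_rw [marginal_add_smul]
      exact (HasDerivAt.fun_sum fun τ _ => hline _ _ (hpos τ)).sub
        ((HasDerivAt.fun_sum fun l _ => hline _ _ (hq l)).const_mul _)
    have h0 := hloc.hasDerivAt_eq_zero hder
    have h1 : ∑ l, (-Real.log (marginal ν l) - 1) * marginal v l =
        -(1 / 3 * ∑ τ, v τ * ∑ i, Real.log (marginal ν (label τ i))) := by
      rw [← sum_marginal v fun l => Real.log (marginal ν l), ← sum_neg_distrib]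
      have h2 : ∑ l, marginal v l = 0 := by
        have := sum_marginal v fun _ => 1
        simpa [← sum_mul, hv] using this
      rw [← sub_zero (∑ l, -_), ← h2, ← sum_sub_distrib]
      exact sum_congr rfl fun l _ => by ring
    rw [h1] at h0
    have h2 : ∑ τ, v τ * A τ = ∑ τ, (-Real.log (ν τ) - 1) * v τ + ∑ τ, v τ +
        1 / 2 * ∑ τ, v τ * ∑ i, Real.log (marginal ν (label τ i)) := by
      rw [← sum_add_distrib, mul_sum, ← sum_add_distrib]
      exact sum_congr rfl fun τ _ => by rw [hA]; ring
    rw [h2, hv]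
    linarith
  obtain ⟨a, b, hab⟩ : ∃ (a : ℝ) (b : ZMod 7 → ℝ),
      ∀ τ, A τ = a + ∑ c, b c * imbalance (Pi.single τ 1) c := by
    have hmem := mem_span_of_iInf_ker_le_ker
      (L := fun o : Option (ZMod 7) => o.elim (∑ τ, LinearMap.proj τ) imbalanceLin)
      (K := ∑ τ, A τ • (LinearMap.proj τ : (VType → ℝ) →ₗ[ℝ] ℝ)) (by
        intro v hv
        simp only [Submodule.mem_iInf, Option.forall, LinearMap.mem_ker, Option.elim] at hv
        have := hstat v (by simpa using hv.1) hv.2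
        simpa [LinearMap.mem_ker, mul_comm] using this)
    obtain ⟨k, hk⟩ := Submodule.mem_span_range_iff_exists_fun ℝ |>.1 hmem
    refine ⟨k none, fun c => k (some c), fun τ => ?_⟩
    have := LinearMap.congr_fun hk (Pi.single τ 1)
    simp [Fintype.sum_option, Pi.single_apply] at this
    exact this.symm
  simp_rw [sum_imbalance_single] at hab
  have htrue : ∀ c, marginal ν (c, true) = marginal ν (c + 1, false) := fun c => sub_eq_zero.1 (hb c)
  set χ : Label → ℝ := fun l => Real.exp (1 / 2 * Real.log (marginal ν l) -
    labelWeight b l) with hχ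
  have hprod : ∀ c, χ (c, true) * χ (c + 1, false) = marginal ν (c + 1, false) := fun c => by
    rw [hχ, ← Real.exp_add]
    simp only [htrue]
    rw [← Real.exp_log (hq (c + 1, false))]
    congr 1
    simp [labelWeight]
    ring
  refine rate_neg_of_product (χ := χ) (Real.exp_pos (-a)) (fun l => Real.exp_pos _) (fun τ => ?_)
    h.2 (fun c => by rw [htrue, hprod]) fun c => (hprod c).symm
  have := hab τ
  rw [hχ, ← Real.exp_sum, ← Real.exp_add, ← Real.exp_log (hpos τ)]
  congr 1
  rw [sum_sub_distrib, ← mul_sum]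
  simp only [hA] at this
  linarith

theorem rate_neg_of_balanced {ν : VType → ℝ} (h : ν ∈ stdSimplex ℝ VType)
    (hb : ∀ c, imbalance ν c = 0) : rate ν < 0 := by
  have hK : IsCompact (stdSimplex ℝ VType ∩ {μ | ∀ c, imbalance μ c = 0}) := by
    refine (isCompact_stdSimplex ℝ VType).inter_right ?_
    simp only [Set.ofPred_forall]
    exact isClosed_iInter fun c => isClosed_eq (continuous_imbalance c) continuous_const
  obtain ⟨μ, hμ, hmax⟩ := hK.exists_isMaxOn ⟨ν, h, hb⟩ continuous_rate.continuousOn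
  exact (hmax ⟨h, hb⟩).trans_lt
    (rate_neg_of_isMaxOn hμ.1 hμ.2 fun σ h1 h2 => hmax ⟨h1, h2⟩)

/-- The growth rate is uniformly negative near the balanced distributions. -/
theorem exists_rate_le : ∃ ε > 0, ∃ δ > 0, ∀ ν ∈ stdSimplex ℝ VType,
    (∀ c, |imbalance ν c| ≤ ε) → rate ν ≤ -δ := by
  have hcont : Continuous fun ν => max (-rate ν) (∑ c, |imbalance ν c|) :=
    continuous_rate.neg.max (continuous_finsetSum _ fun c _ => (continuous_imbalance c).abs)
  obtain ⟨μ, hμ, hmin⟩ := (isCompact_stdSimplex ℝ VType).exists_isMinOn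
    ⟨center, fun τ => (center_pos τ).le, sum_center⟩ hcont.continuousOn
  set m := max (-rate μ) (∑ c, |imbalance μ c|) with hm
  have hpos : 0 < m := by
    by_contra hcon
    obtain ⟨h1, h2⟩ := max_le_iff.1 (not_lt.1 hcon)
    have h3 := (sum_eq_zero_iff_of_nonneg fun c _ => abs_nonneg (imbalance μ c)).1
      (le_antisymm h2 (sum_nonneg fun c _ => abs_nonneg _))
    linarith [rate_neg_of_balanced hμ fun c => abs_eq_zero.1 (h3 c (mem_univ c))]
  refine ⟨m / 8, by positivity, m, hpos, fun ν hν hb => ?_⟩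
  have h1 : ∑ c, |imbalance ν c| ≤ 7 * (m / 8) := by
    have := sum_le_sum fun c (_ : c ∈ univ) => hb c
    simpa [ZMod.card] using this
  have h2 : m ≤ max (-rate ν) (∑ c, |imbalance ν c|) := hmin hν
  rcases le_max_iff.1 h2 with h | h <;> linarith

section Potential

open Nat

variable {P ι : Type*} [DecidableEq P] [Fintype ι] [DecidableEq ι]

/-- The number of points of `U` with a given slot. -/
def slotCount (l : P → ι × Bool) (U : Finset P) (s : ι × Bool) : ℕ := #{p ∈ U | l p = s}

/-- The potential of a slot assignment on the unmatched points. -/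
def potential (l : P → ι × Bool) (U : Finset P) : ℕ :=
  ∏ c, (max (slotCount l U (c, true)) (slotCount l U (c, false)))!

omit [DecidableEq P] in
lemma potential_pos (l : P → ι × Bool) (U : Finset P) : 0 < potential l U :=
  prod_pos fun _ _ => factorial_pos _

/-- Two slots fit if they can be joined by an edge. -/
def Fits (s t : ι × Bool) : Prop := s.1 = t.1 ∧ s.2 ≠ t.2

instance (s t : ι × Bool) : Decidable (Fits s t) := inferInstanceAs (Decidable (_ ∧ _))

omit [Fintype ι] in
lemma slotCount_erase (l : P → ι × Bool) {U : Finset P} {p : P} (hp : p ∈ U) (s : ι × Bool) :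
    slotCount l (U.erase p) s + (if l p = s then 1 else 0) = slotCount l U s := by
  unfold slotCount
  rw [filter_erase]
  split_ifs with h
  · exact card_erase_add_one (by simp [hp, h])
  · rw [erase_eq_of_notMem (by simp [h]), add_zero]

lemma mul_potential_erase (l : P → ι × Bool) {U : Finset P} {p q : P} (hp : p ∈ U)
    (hq : q ∈ U.erase p) (h : Fits (l p) (l q)) :
    max (slotCount l U ((l p).1, true)) (slotCount l U ((l p).1, false)) *
      potential l ((U.erase p).erase q) = potential l U := by
  have h1 := fun s => slotCount_erase l hp s
  have h2 := fun s => slotCount_erase l hq s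
  have hc : ∀ b, slotCount l ((U.erase p).erase q) ((l p).1, b) + 1 =
      slotCount l U ((l p).1, b) := fun b => by
    rw [← h1, ← h2]
    obtain ⟨e1, e2⟩ := h
    generalize l p = x, l q = y at *
    rcases x with ⟨x, _ | _⟩ <;> rcases y with ⟨y, _ | _⟩ <;> cases b <;> simp_all
  unfold potential
  rw [← mul_prod_erase univ _ (mem_univ (l p).1), ← mul_prod_erase univ _ (mem_univ (l p).1),
    ← mul_assoc, ← hc, ← hc, max_add_add_right, ← factorial_succ]
  congr 1
  refine prod_congr rfl fun c hc => ?_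
  have hb : ∀ b, slotCount l ((U.erase p).erase q) (c, b) = slotCount l U (c, b) := fun b => by
    rw [← h1, ← h2]
    have := ne_of_mem_erase hc
    rw [if_neg, if_neg, add_zero, add_zero] <;> intro e
    · exact this (by rw [e])
    · exact this (by rw [h.1, e])
  simp only [hb]

/-- Summing the potential over all ways of matching `p` does not increase it. -/
lemma sum_potential_erase_le (l : P → ι × Bool) {U : Finset P} {p : P} (hp : p ∈ U) :
    ∑ q ∈ U.erase p, (if Fits (l p) (l q) then potential l ((U.erase p).erase q) else 0) ≤
      potential l U := by
  rw [← sum_filter]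
  set m := max (slotCount l U ((l p).1, true)) (slotCount l U ((l p).1, false)) with hm
  have hmpos : 0 < m := by
    have : 0 < slotCount l U (l p) := card_pos.2 ⟨p, by simp [hp]⟩
    rw [hm]
    rcases hl : l p with ⟨c, _ | _⟩ <;> rw [hl] at this <;> simp [this]
  have hcard : #{q ∈ U.erase p | Fits (l p) (l q)} ≤ m := by
    have : #{q ∈ U.erase p | Fits (l p) (l q)} ≤ slotCount l U ((l p).1, !(l p).2) := by
      refine card_le_card fun q hq => ?_
      obtain ⟨h1, h2, h3⟩ := mem_filter.1 hq
      refine mem_filter.2 ⟨mem_of_mem_erase h1, Prod.ext h2.symm ?_⟩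
      cases h : (l p).2 <;> cases h' : (l q).2 <;> simp_all
    refine this.trans ?_
    rw [hm]
    cases (l p).2 <;> simp
  refine Nat.le_of_mul_le_mul_left ?_ hmpos
  rw [mul_sum, sum_congr rfl fun q hq => mul_potential_erase l hp (mem_filter.1 hq).1
    (mem_filter.1 hq).2, sum_const, smul_eq_mul]
  exact Nat.mul_le_mul_right _ hcard

lemma factorial_le_mul_pow {a b n K : ℕ} (h : a ≤ b) (hK : b ≤ a + K) (hb : b ≤ n) (hn : 0 < n) :
    b ! ≤ a ! * n ^ K := by
  have h1 := factorial_mul_descFactorial (Nat.sub_le b a)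
  rw [Nat.sub_sub_self h] at h1
  rw [← h1]
  refine Nat.mul_le_mul_left _ ((descFactorial_le_pow _ _).trans ?_)
  exact (Nat.pow_le_pow_left hb _).trans (Nat.pow_le_pow_right hn (by omega))

omit [DecidableEq P] in
lemma potential_sq_le (l : P → ι × Bool) {U : Finset P} (hU : U.Nonempty) {K : ℕ}
    (h1 : ∀ c, slotCount l U (c, true) ≤ slotCount l U (c, false) + K)
    (h2 : ∀ c, slotCount l U (c, false) ≤ slotCount l U (c, true) + K) :
    potential l U ^ 2 ≤ (#U ^ K) ^ Fintype.card ι * ∏ s, (slotCount l U s)! := by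
  have hle : ∀ s, slotCount l U s ≤ #U := fun s => card_filter_le _ _
  rw [Fintype.prod_prod_type, ← Finset.card_univ, ← prod_const, ← prod_mul_distrib, potential, ← prod_pow]
  refine prod_le_prod' fun c _ => ?_
  rw [Fintype.prod_bool, sq]
  rcases le_total (slotCount l U (c, true)) (slotCount l U (c, false)) with h | h
  · rw [max_eq_right h]
    have := Nat.mul_le_mul_right (slotCount l U (c, false))!
      (factorial_le_mul_pow h (h2 c) (hle _) hU.card_pos)
    linarith
  · rw [max_eq_left h]
    have := Nat.mul_le_mul_left (slotCount l U (c, true))!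
      (factorial_le_mul_pow h (h1 c) (hle _) hU.card_pos)
    linarith

end Potential

section Stirling

open Nat

lemma log_factorial_le (m : ℕ) :
    Real.log (m ! : ℝ) ≤ m * Real.log m - m + 1 + Real.log (m + 1) := by
  rcases Nat.eq_zero_or_pos m with rfl | hm
  · simp
  have key : Real.log (m ! : ℝ) ≤ m * Real.log m - m + 1 + Real.log m := by
    induction m, hm using Nat.le_induction with
    | base => simp
    | succ m hm ih =>
      have hm0 : (0 : ℝ) < m := by exact_mod_cast hm
      have h1 := Real.log_le_sub_one_of_pos (div_pos hm0 (by positivity : (0 : ℝ) < m + 1))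
      rw [Real.log_div hm0.ne' (by positivity), div_sub_one (by positivity), le_div_iff₀ (by positivity)] at h1
      rw [factorial_succ]
      push_cast
      rw [Real.log_mul (by positivity) (by positivity)]
      linarith
  have : Real.log m ≤ Real.log (m + 1) :=
    Real.log_le_log (by exact_mod_cast hm) (by linarith)
  linarith

lemma le_log_factorial (n : ℕ) : n * Real.log n - n ≤ Real.log (n ! : ℝ) := by
  rcases Nat.eq_zero_or_pos n with rfl | hn
  · simp
  have hn0 : (0 : ℝ) < n := by exact_mod_cast hn
  have h := Real.pow_div_factorial_le_exp (n : ℝ) hn0.le n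
  have h1 := Real.log_le_log (by positivity) h
  rw [Real.log_exp, Real.log_div (by positivity) (by positivity), Real.log_pow] at h1
  linarith

lemma log_prod_factorial_le {S : Type*} [Fintype S] (m : S → ℕ) {n : ℕ} (hn : 0 < n)
    (h : ∑ s, m s = n) :
    Real.log (∏ s, ((m s)! : ℝ)) ≤ Real.log (n ! : ℝ) -
      n * ∑ s, Real.negMulLog (m s / n) + Fintype.card S * (1 + Real.log (n + 1)) := by
  have hn0 : (0 : ℝ) < n := by exact_mod_cast hn
  have h1 : ∀ s, n * Real.negMulLog (m s / n) = m s * Real.log n - m s * Real.log (m s) := by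
    intro s
    rcases Nat.eq_zero_or_pos (m s) with h0 | h0
    · simp [h0]
    · have : (0 : ℝ) < m s := by exact_mod_cast h0
      rw [Real.negMulLog, Real.log_div this.ne' hn0.ne']
      field_simp
      ring
  have hsum : ∑ s, (m s : ℝ) = n := by exact_mod_cast h
  rw [Real.log_prod fun s _ => by positivity, mul_sum]
  simp_rw [h1]
  have h2 : ∀ s, Real.log ((m s)! : ℝ) ≤ m s * Real.log (m s) - m s + (1 + Real.log (n + 1)) := by
    intro s
    have h3 := log_factorial_le (m s)
    have h4 : m s ≤ n := h ▸ single_le_sum (fun _ _ => Nat.zero_le _) (mem_univ s)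
    have h5 : Real.log ((m s : ℝ) + 1) ≤ Real.log (n + 1) :=
      Real.log_le_log (by positivity) (by exact_mod_cast Nat.succ_le_succ h4)
    linarith
  have h3 := sum_le_sum fun s (_ : s ∈ univ) => h2 s
  have h4 := le_log_factorial n
  rw [sum_add_distrib, sum_sub_distrib, hsum, sum_const, Finset.card_univ, nsmul_eq_mul] at h3
  rw [sum_sub_distrib, ← sum_mul, hsum]
  linarith

lemma log_factorial_sub_le (n C : ℕ) (h : C + 1 ≤ n) :
    Real.log (n ! : ℝ) ≤ Real.log ((n - 1 - C)! : ℝ) + (C + 1) * Real.log n := by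
  have h1 := factorial_mul_descFactorial h
  have h2 := descFactorial_le_pow n (C + 1)
  have h3 : n ! ≤ (n - 1 - C)! * n ^ (C + 1) := by
    rw [← h1, show n - (C + 1) = n - 1 - C by omega]
    exact Nat.mul_le_mul_left _ h2
  have hn : (0 : ℝ) < n := by exact_mod_cast (by omega : 0 < n)
  have h4 := Real.log_le_log (by positivity) (by exact_mod_cast h3 : (n ! : ℝ) ≤ (n - 1 - C)! * n ^ (C + 1))
  rw [Real.log_mul (by positivity) (by positivity), Real.log_pow] at h4
  push_cast at h4
  exact h4

end Stirling

section Frequency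

variable {T : Type*} [Fintype T] [DecidableEq T] {N : ℕ}

/-- The empirical distribution of a word. -/
noncomputable def freq (τ : Fin N → T) (t : T) : ℝ := #{v | τ v = t} / N

lemma sum_comp_eq_sum_freq (hN : 0 < N) (τ : Fin N → T) (G : T → ℝ) :
    ∑ v, G (τ v) = N * ∑ t, freq τ t * G t := by
  have hN0 : (N : ℝ) ≠ 0 := by positivity
  have h : ∀ v, G (τ v) = ∑ t, if τ v = t then G t else 0 := fun v => by simp
  simp_rw [h]
  rw [sum_comm, mul_sum]
  refine sum_congr rfl fun t _ => ?_
  rw [← sum_filter, sum_const, nsmul_eq_mul, freq]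
  field_simp

lemma freq_mem_stdSimplex (hN : 0 < N) (τ : Fin N → T) : freq τ ∈ stdSimplex ℝ T := by
  refine ⟨fun t => by unfold freq; positivity, ?_⟩
  have h := sum_comp_eq_sum_freq hN τ fun _ => 1
  have hN0 : (0 : ℝ) < N := by exact_mod_cast hN
  simp only [sum_const, card_univ, Fintype.card_fin, nsmul_eq_mul, mul_one] at h
  exact (mul_right_eq_self₀.1 h.symm).resolve_right hN0.ne'

lemma prod_freq (hN : 0 < N) (τ : Fin N → T) :
    ∏ v, freq τ (τ v) = Real.exp (-(N * ∑ t, Real.negMulLog (freq τ t))) := by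
  have hpos : ∀ v, 0 < freq τ (τ v) := fun v => by
    have : 0 < #{w | τ w = τ v} := card_pos.2 ⟨v, by simp⟩
    unfold freq
    positivity
  rw [← Real.exp_log (prod_pos fun v _ => hpos v), Real.log_prod fun v _ => (hpos v).ne',
    sum_comp_eq_sum_freq hN τ fun t => Real.log (freq τ t), ← mul_neg, ← sum_neg_distrib]
  simp [Real.negMulLog]

lemma sum_prod_freq_le (hN : 0 < N) :
    ∑ τ : Fin N → T, ∏ v, freq τ (τ v) ≤ ((N : ℝ) + 1) ^ Fintype.card T := by
  have hN0 : (0 : ℝ) < N := by exact_mod_cast hN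
  let c : (Fin N → T) → T → Fin (N + 1) := fun τ t =>
    ⟨#{v | τ v = t}, Nat.lt_succ_of_le ((card_filter_le _ _).trans (by simp))⟩
  rw [← sum_fiberwise univ c]
  have h : ∀ m : T → Fin (N + 1), ∑ τ with c τ = m, ∏ v, freq τ (τ v) ≤ 1 := fun m => by
    rcases eq_empty_or_nonempty {τ | c τ = m} with he | ⟨σ, hσ⟩
    · rw [he]; simp
    have hfreq : ∀ τ, c τ = m → freq τ = freq σ := fun τ hτ => by
      funext t
      have := congrFun (hτ.trans (mem_filter.1 hσ).2.symm) t
      have : #{v | τ v = t} = #{v | σ v = t} := congrArg Fin.val this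
      rw [freq, freq, this]
    calc ∑ τ with c τ = m, ∏ v, freq τ (τ v) = ∑ τ with c τ = m, ∏ v, freq σ (τ v) :=
          sum_congr rfl fun τ hτ => by rw [hfreq τ (mem_filter.1 hτ).2]
      _ ≤ ∑ τ : Fin N → T, ∏ v, freq σ (τ v) :=
          sum_le_sum_of_subset_of_nonneg (filter_subset _ _) fun τ _ _ =>
            prod_nonneg fun v _ => (freq_mem_stdSimplex hN σ).1 _
      _ = 1 := by rw [← Fintype.sum_pow, (freq_mem_stdSimplex hN σ).2, one_pow]
  refine (sum_le_sum fun m _ => h m).trans ?_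
  simp

end Frequency

/-- The slot of a label: the class of the edges through such half-edges, and the direction. -/
def slot : Label ≃ ZMod 7 × Bool where
  toFun l := (if l.2 then l.1 else l.1 - 1, l.2)
  invFun s := (if s.2 then s.1 else s.1 + 1, s.2)
  left_inv := by rintro ⟨c, _ | _⟩ <;> simp
  right_inv := by rintro ⟨c, _ | _⟩ <;> simp

/-- The slots of the half-edges at vertices of given types. -/
def slots {N : ℕ} (τ : Fin N → VType) (p : Fin N × Fin 3) : ZMod 7 × Bool :=
  slot (label (τ p.1) p.2)

lemma slotCount_slots {N : ℕ} (hN : 0 < N) (τ : Fin N → VType) (s) :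
    (slotCount (slots τ) univ s : ℝ) = 3 * N * marginal (freq τ) (slot.symm s) := by
  have h := sum_comp_eq_sum_freq hN τ fun t => ∑ i, if label t i = slot.symm s then (1 : ℝ) else 0
  have h1 : marginal (freq τ) (slot.symm s) =
      1 / 3 * ∑ t, freq τ t * ∑ i, if label t i = slot.symm s then (1 : ℝ) else 0 := by
    unfold marginal
    congr 1
    refine sum_congr rfl fun t _ => ?_
    rw [mul_sum]
    exact sum_congr rfl fun i _ => by simp
  have h2 : ∀ v i, (if slots τ (v, i) = s then (1 : ℝ) else 0) =
      if label (τ v) i = slot.symm s then 1 else 0 := fun v i =>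
    if_congr (slot.eq_symm_apply).symm rfl rfl
  rw [h1, slotCount, card_filter, Fintype.sum_prod_type]
  push_cast
  simp_rw [h2]
  rw [h]
  ring

/-- The set of type assignments with almost balanced slots. -/
def balancedTypes (N K : ℕ) : Finset (Fin N → VType) :=
  {τ | ∀ c, slotCount (slots τ) univ (c, true) ≤ slotCount (slots τ) univ (c, false) + K ∧
    slotCount (slots τ) univ (c, false) ≤ slotCount (slots τ) univ (c, true) + K}

lemma log_le_of_sq_le {ι : Type*} [Fintype ι] {m : ι → ℕ} {a n K : ℕ} (ha : 0 < a) (hn : 0 < n)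
    (h : a ^ 2 ≤ (n ^ K) ^ 7 * ∏ s, (m s).factorial) :
    2 * Real.log a ≤ 7 * (K * Real.log n) + Real.log (∏ s, ((m s).factorial : ℝ)) := by
  have hn' : (n : ℝ) ≠ 0 := by exact_mod_cast hn.ne'
  have h1 : (a : ℝ) ^ 2 ≤ ((n : ℝ) ^ K) ^ 7 * ∏ s, ((m s).factorial : ℝ) := by exact_mod_cast h
  have h2 := Real.log_le_log (pow_pos (Nat.cast_pos.2 ha) 2) h1
  rw [Real.log_mul (pow_ne_zero _ (pow_ne_zero _ hn'))
    (prod_pos fun s _ => Nat.cast_pos.2 (Nat.factorial_pos _)).ne', Real.log_pow,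
    Real.log_pow, Real.log_pow] at h2
  exact_mod_cast h2

lemma potential_le {N K : ℕ} (hN : 0 < N) {δ : ℝ} {τ : Fin N → VType} (hτ : τ ∈ balancedTypes N K)
    (hrate : rate (freq τ) ≤ -δ) :
    (potential (slots τ) univ : ℝ) ≤
      Real.exp ((Real.log ((3 * N).factorial) + (7 * K + 14) * Real.log (3 * N + 1) + 14) / 2 -
        δ * N) * ∏ v, freq τ (τ v) := by
  have hN0 : (0 : ℝ) < N := by exact_mod_cast hN
  have hb : ∀ c, _ := (mem_filter.1 hτ).2
  have hcard : #(univ : Finset (Fin N × Fin 3)) = 3 * N := by simp [mul_comm]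
  have h1 := potential_sq_le (slots τ) (U := univ) (K := K) ⟨(⟨0, hN⟩, 0), mem_univ _⟩
    (fun c => (hb c).1) fun c => (hb c).2
  rw [hcard, ZMod.card] at h1
  have h2 := log_le_of_sq_le (potential_pos (slots τ) univ) (by omega : 0 < 3 * N) h1
  have hsum : ∑ s, slotCount (slots τ) univ s = 3 * N := by
    rw [← hcard]
    exact (card_eq_sum_card_fiberwise (f := slots τ) (t := univ)
      fun _ _ => mem_coe.2 (mem_univ _)).symm
  have h3 := log_prod_factorial_le _ (by omega : 0 < 3 * N) hsum
  have h4 : ∑ s, Real.negMulLog (slotCount (slots τ) univ s / (3 * N : ℕ)) =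
      ∑ l, Real.negMulLog (marginal (freq τ) l) := by
    rw [← slot.symm.sum_comp fun l => Real.negMulLog (marginal (freq τ) l)]
    refine sum_congr rfl fun s _ => ?_
    rw [slotCount_slots hN]
    push_cast
    rw [mul_div_cancel_left₀ _ (by positivity)]
  have h5 : (7 * K : ℝ) * Real.log (3 * N) ≤ 7 * K * Real.log (3 * N + 1) :=
    mul_le_mul_of_nonneg_left (Real.log_le_log (mul_pos three_pos hN0) (le_add_of_nonneg_right
      zero_le_one)) (mul_nonneg (Nat.ofNat_nonneg 7) K.cast_nonneg)
  rw [h4] at h3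
  simp only [Fintype.card_prod, ZMod.card, Fintype.card_bool] at h3
  push_cast at h2 h3
  rw [prod_freq hN, ← Real.exp_add, ← Real.log_le_iff_le_exp (Nat.cast_pos.2 (potential_pos _ _))]
  have h6 := mul_le_mul_of_nonneg_left hrate hN0.le
  unfold rate at h6
  linarith

open Filter in
theorem exists_sum_potential_lt (C K : ℕ) : ∃ N > 0, C + 2 ≤ 3 * N ∧
    (∑ τ ∈ balancedTypes N K, potential (slots τ) univ) ^ 2 < (3 * N - 1 - C).factorial := by
  obtain ⟨ε, hε, δ, hδ, hrate⟩ := exists_rate_le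
  set k := Fintype.card VType
  set A : ℝ := 7 * K + 15 + C + 2 * k with hA
  have hApos : 0 < A := by positivity
  have hlog : ∀ᶠ N : ℕ in atTop, Real.log (3 * N + 1) ≤ δ / (3 * A) * (3 * N + 1) := by
    have h1 := Real.isLittleO_log_id_atTop.def (by positivity : 0 < δ / (3 * A))
    have h2 : Tendsto (fun N : ℕ => 3 * (N : ℝ) + 1) atTop atTop :=
      tendsto_atTop_add_const_right _ _
        (Tendsto.const_mul_atTop (by norm_num) tendsto_natCast_atTop_atTop)
    filter_upwards [h2.eventually h1] with N hN
    rw [Real.norm_eq_abs, Real.norm_eq_abs, id, abs_of_nonneg (by positivity : (0 : ℝ) ≤ 3 * N + 1)] at hN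
    exact (le_abs_self _).trans hN
  obtain ⟨N, hN1, hN2, hN3, hN4, hN5⟩ := (hlog.and ((eventually_gt_atTop 0).and
    ((eventually_ge_atTop (C + 2)).and (((tendsto_natCast_atTop_atTop (R := ℝ)).eventually_gt_atTop
      ((14 + δ / 3) / δ)).and ((tendsto_natCast_atTop_atTop (R := ℝ)).eventually_ge_atTop
      (K / ε)))))).exists
  refine ⟨N, hN2, by omega, ?_⟩
  have hN0 : (0 : ℝ) < N := by exact_mod_cast hN2
  set E := (Real.log ((3 * N).factorial) + (7 * K + 14) * Real.log (3 * N + 1) + 14) / 2 - δ * N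
    with hE
  have hsum : ((∑ τ ∈ balancedTypes N K, potential (slots τ) univ : ℕ) : ℝ) ≤
      Real.exp E * (N + 1) ^ k := by
    push_cast
    calc _ ≤ ∑ τ ∈ balancedTypes N K, Real.exp E * ∏ v, freq τ (τ v) := by
          refine sum_le_sum fun τ hτ => potential_le hN2 hτ (hrate _ (freq_mem_stdSimplex hN2 τ) ?_)
          intro c
          obtain ⟨h1, h2⟩ := (mem_filter.1 hτ).2 c
          have h1' : (slotCount (slots τ) univ (c, true) : ℝ) ≤
            slotCount (slots τ) univ (c, false) + K := by exact_mod_cast h1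
          have h2' : (slotCount (slots τ) univ (c, false) : ℝ) ≤
            slotCount (slots τ) univ (c, true) + K := by exact_mod_cast h2
          rw [slotCount_slots hN2, slotCount_slots hN2] at h1' h2'
          have e1 : slot.symm (c, true) = (c, true) := rfl
          have e2 : slot.symm (c, false) = (c + 1, false) := rfl
          rw [e1, e2] at h1' h2'
          rw [div_le_iff₀ hε] at hN5
          have h3 : |N * imbalance (freq τ) c| ≤ N * ε := by
            unfold imbalance
            have := Nat.cast_nonneg (α := ℝ) K
            rw [abs_le]; constructor <;> linarith
          rw [abs_mul, abs_of_pos hN0] at h3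
          exact le_of_mul_le_mul_left h3 hN0
      _ ≤ ∑ τ : Fin N → VType, Real.exp E * ∏ v, freq τ (τ v) :=
          sum_le_sum_of_subset_of_nonneg (subset_univ _) fun τ _ _ => mul_nonneg (Real.exp_pos _).le
            (prod_nonneg fun v _ => (freq_mem_stdSimplex hN2 τ).1 _)
      _ ≤ _ := by
          rw [← mul_sum]
          exact mul_le_mul_of_nonneg_left (sum_prod_freq_le hN2) (Real.exp_pos _).le
  have hlt : (Real.exp E * ((N : ℝ) + 1) ^ k) ^ 2 < ((3 * N - 1 - C).factorial : ℝ) := by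
    rw [← Real.log_lt_log_iff (by positivity) (by positivity), Real.log_pow,
      Real.log_mul (by positivity) (by positivity), Real.log_exp, Real.log_pow]
    have h1 := log_factorial_sub_le (3 * N) C (by omega)
    have h2 : Real.log (N + 1) ≤ Real.log (3 * N + 1) :=
      Real.log_le_log (by positivity) (by linarith)
    have h3 : Real.log (3 * N) ≤ Real.log (3 * N + 1) :=
      Real.log_le_log (by positivity) (by linarith)
    have h2' := mul_le_mul_of_nonneg_left h2 (by positivity : (0 : ℝ) ≤ 2 * k)
    have h3' := mul_le_mul_of_nonneg_left h3 (by positivity : (0 : ℝ) ≤ C + 1)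
    have h4 := mul_le_mul_of_nonneg_left hN1 hApos.le
    have h5 : A * (δ / (3 * A) * (3 * N + 1)) = δ * N + δ / 3 := by field_simp
    rw [h5] at h4
    rw [div_lt_iff₀ hδ] at hN4
    push_cast at h1 ⊢
    rw [hE]
    rw [hA] at h4
    linarith
  have := (pow_le_pow_left₀ (by positivity) hsum 2).trans_lt hlt
  exact_mod_cast this

end CycleType

namespace SimpleGraph

variable {V : Type*} {G H : SimpleGraph V} {g : ℕ} {u v : V}

/-- The ends of every edge are at distance at least `g - 1` once the edge is deleted. -/
def HasGirth (g : ℕ) (G : SimpleGraph V) : Prop :=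
  ∀ ⦃u v⦄, G.Adj u v → ∀ w : (G.deleteEdges {s(u, v)}).Walk u v, g ≤ w.length + 1

lemma HasGirth.natCast_le_egirth (h : G.HasGirth g) : (g : ℕ∞) ≤ G.egirth := by
  rw [le_egirth]
  intro a w hw
  cases w with
  | nil => exact absurd hw Walk.not_isCycle_nil
  | cons hadj p =>
    rw [Walk.cons_isCycle_iff] at hw
    have := h hadj.symm (p.toDeleteEdges {s(_, a)} fun e he he' => hw.2 (by
      rw [Set.mem_singleton_iff] at he'
      rwa [← Sym2.eq_swap, ← he']))
    rw [Walk.length_cons]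
    rw [Walk.length_transfer] at this
    exact_mod_cast this

lemma HasGirth.mono (h : G.HasGirth g) (hle : H ≤ G) : H.HasGirth g := fun u v huv w => by
  simpa using h (hle huv) (w.mapLe (deleteEdges_mono hle))

lemma Walk.exists_of_sup_edge {a b : V} (w : (G ⊔ edge u v).Walk a b) :
    (∃ w' : G.Walk a b, w'.length ≤ w.length) ∨
    (∃ (w₁ : G.Walk a u) (w₂ : G.Walk v b), w₁.length + w₂.length + 1 ≤ w.length) ∨
    ∃ (w₁ : G.Walk a v) (w₂ : G.Walk u b), w₁.length + w₂.length + 1 ≤ w.length := by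
  induction w with
  | nil => exact Or.inl ⟨.nil, le_rfl⟩
  | cons h p ih =>
    rw [sup_adj, edge_adj] at h
    simp only [length_cons]
    rcases h with h | ⟨⟨rfl, rfl⟩ | ⟨rfl, rfl⟩, -⟩
    · rcases ih with ⟨w, hw⟩ | ⟨w₁, w₂, hw⟩ | ⟨w₁, w₂, hw⟩
      · exact Or.inl ⟨.cons h w, by simpa using hw⟩
      · exact Or.inr (Or.inl ⟨.cons h w₁, w₂, by rw [length_cons]; omega⟩)
      · exact Or.inr (Or.inr ⟨.cons h w₁, w₂, by rw [length_cons]; omega⟩)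
    · rcases ih with ⟨w, hw⟩ | ⟨w₁, w₂, hw⟩ | ⟨w₁, w₂, hw⟩
      · exact Or.inr (Or.inl ⟨.nil, w, by simpa using hw⟩)
      · exact Or.inr (Or.inl ⟨.nil, w₂, by rw [length_nil]; omega⟩)
      · exact Or.inl ⟨w₂, by omega⟩
    · rcases ih with ⟨w, hw⟩ | ⟨w₁, w₂, hw⟩ | ⟨w₁, w₂, hw⟩
      · exact Or.inr (Or.inr ⟨.nil, w, by simpa using hw⟩)
      · exact Or.inl ⟨w₂, by omega⟩
      · exact Or.inr (Or.inr ⟨.nil, w₂, by rw [length_nil]; omega⟩)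

lemma HasGirth.sup_edge (h : G.HasGirth g) (huv : ∀ w : G.Walk u v, g ≤ w.length + 1) :
    (G ⊔ edge u v).HasGirth g := by
  intro a b hab w
  by_cases hG : G.Adj a b
  · have hle : (G ⊔ edge u v).deleteEdges {s(a, b)} ≤ G.deleteEdges {s(a, b)} ⊔ edge u v := by
      intro x y
      simp only [deleteEdges_adj, sup_adj]
      tauto
    have hG' : G.deleteEdges {s(a, b)} ≤ G := deleteEdges_le _
    rw [← Walk.length_mapLe hle w]
    rcases (w.mapLe hle).exists_of_sup_edge with ⟨w, hw⟩ | ⟨w₁, w₂, hw⟩ | ⟨w₁, w₂, hw⟩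
    · have := h hG w
      omega
    · have := huv (((w₁.mapLe hG').reverse.concat hG).append (w₂.mapLe hG').reverse)
      simp only [Walk.length_append, Walk.length_concat, Walk.length_reverse,
        Walk.length_mapLe] at this
      omega
    · have := huv (((w₂.mapLe hG').concat hG.symm).append (w₁.mapLe hG'))
      simp only [Walk.length_append, Walk.length_concat, Walk.length_mapLe] at this
      omega
  · have hab' := (sup_adj _ _ _ _).1 hab |>.resolve_left hG
    rw [edge_adj] at hab'
    have hle : (G ⊔ edge u v).deleteEdges {s(a, b)} ≤ G := by
      intro x y hxy
      rw [deleteEdges_adj, sup_adj, edge_adj, Set.mem_singleton_iff, Sym2.eq_iff] at hxy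
      aesop
    rcases hab' with ⟨⟨rfl, rfl⟩ | ⟨rfl, rfl⟩, -⟩
    · simpa using huv (w.mapLe hle)
    · simpa using huv (w.mapLe hle).reverse

lemma exists_ball [DecidableEq V] {nb : V → Finset V} (hnb : ∀ v, (nb v).card ≤ 3)
    (hadj : ∀ u v, G.Adj u v → v ∈ nb u) (k : ℕ) (u : V) :
    ∃ B : Finset V, B.card ≤ 4 ^ k ∧ ∀ v (w : G.Walk u v), w.length ≤ k → v ∈ B := by
  induction k generalizing u with
  | zero =>
    refine ⟨{u}, by simp, fun v w hw => ?_⟩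
    rw [← Walk.eq_of_length_eq_zero (Nat.le_zero.1 hw)]
    exact Finset.mem_singleton_self u
  | succ k ih =>
    choose B hB hmem using ih
    refine ⟨(insert u (nb u)).biUnion B, ?_, fun v w hw => ?_⟩
    · refine (Finset.card_biUnion_le_card_mul _ _ _ fun x _ => hB x).trans ?_
      rw [pow_succ']
      exact Nat.mul_le_mul_right _ ((Finset.card_insert_le _ _).trans (by grind))
    · rw [Finset.mem_biUnion]
      cases w with
      | nil => exact ⟨u, Finset.mem_insert_self _ _, hmem u u .nil (Nat.zero_le _)⟩
      | cons h p =>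
        exact ⟨_, Finset.mem_insert_of_mem (hadj _ _ h), hmem _ v p (by simpa using hw)⟩

end SimpleGraph

namespace HalfEdge

open SimpleGraph Function

section Link
variable {P : Type*} [DecidableEq P] {σ : P → P} {p q x : P}

/-- Exchange the partners of two half-edges: this joins two free half-edges, and separates two
joined ones. -/
def link (σ : P → P) (p q : P) : P → P := fun x => Equiv.swap p q (σ x)

lemma link_involutive (hσ : Involutive σ) (hp : σ p = p) (hq : σ q = q) :
    Involutive (link σ p q) := by
  intro x
  have := hσ x
  have := hσ.injective
  unfold link
  grind [Injective]

lemma unlink_involutive (hσ : Involutive σ) : Involutive (link σ p (σ p)) := by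
  intro x
  have := hσ x
  have := hσ p
  have := hσ.injective
  unfold link
  grind [Injective]

lemma link_apply (hσ : Involutive σ) (hp : σ p = p) (hq : σ q = q) (x : P) :
    link σ p q x = if x = p then q else if x = q then p else σ x := by
  have := hσ x
  unfold link
  grind

lemma unlink_apply (hσ : Involutive σ) (x : P) :
    link σ p (σ p) x = if x = p then p else if x = σ p then σ p else σ x := by
  have := hσ x
  have := hσ p
  unfold link
  grind

end Link

variable {V : Type*} {g : ℕ} {σ : V × Fin 3 → V × Fin 3} {p q : V × Fin 3}

/-- The graph whose edges are the pairs of half-edges joined by `σ`; every vertex carries three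
half-edges, and the fixed points of `σ` are free. -/
def graph (σ : V × Fin 3 → V × Fin 3) : SimpleGraph V :=
  .fromRel fun u v => ∃ i, (σ (u, i)).1 = v

/-- A pairing of half-edges without loops or multiple edges, and with no short cycles. -/
structure IsPairing (g : ℕ) (σ : V × Fin 3 → V × Fin 3) : Prop where
  invol : Involutive σ
  simple : ∀ v i j, σ (v, i) ≠ (v, i) → (σ (v, i)).1 = (σ (v, j)).1 → i = j
  girth : (graph σ).HasGirth g

lemma graph_adj (hσ : Involutive σ) {u v : V} :
    (graph σ).Adj u v ↔ u ≠ v ∧ ∃ i, (σ (u, i)).1 = v := by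
  have key : ∀ {u v}, (∃ i, (σ (u, i)).1 = v) → ∃ i, (σ (v, i)).1 = u := by
    rintro u _ ⟨i, rfl⟩
    exact ⟨(σ (u, i)).2, by rw [Prod.mk.eta, hσ]⟩
  rw [graph, fromRel_adj]
  exact and_congr_right fun _ => ⟨fun h => h.elim id key, Or.inl⟩

namespace IsPairing

lemma fst_ne (h : IsPairing g σ) (hp : σ p ≠ p) : (σ p).1 ≠ p.1 := by
  intro he
  have h1 := h.simple p.1 p.2 (σ p).2 hp
  rw [← he, Prod.mk.eta, h.invol] at h1
  exact hp (Prod.ext he (h1 (by rw [he, Prod.mk.eta, he])).symm)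

lemma adj (h : IsPairing g σ) (hp : σ p ≠ p) : (graph σ).Adj p.1 (σ p).1 :=
  (graph_adj h.invol).2 ⟨(h.fst_ne hp).symm, p.2, rfl⟩

variable [DecidableEq V]

lemma graph_link (h : IsPairing g σ) (hp : σ p = p) (hq : σ q = q) :
    graph (link σ p q) = graph σ ⊔ edge p.1 q.1 := by
  ext u v
  rw [graph_adj (link_involutive h.invol hp hq), sup_adj, graph_adj h.invol, edge_adj]
  simp only [link_apply h.invol hp hq]
  constructor
  · rintro ⟨huv, i, rfl⟩
    grind
  · rintro (⟨huv, i, rfl⟩ | ⟨⟨rfl, rfl⟩ | ⟨rfl, rfl⟩, huv⟩)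
    · exact ⟨huv, i, by grind⟩
    · exact ⟨huv, p.2, by grind⟩
    · exact ⟨huv, q.2, by grind⟩

protected lemma link (h : IsPairing g σ) (hg : 3 ≤ g) (hp : σ p = p) (hq : σ q = q)
    (hfar : ∀ w : (graph σ).Walk p.1 q.1, g ≤ w.length + 1) : IsPairing g (link σ p q) where
  invol := link_involutive h.invol hp hq
  girth := by
    rw [h.graph_link hp hq]
    exact h.girth.sup_edge hfar
  simple := by
    have hne : p.1 ≠ q.1 := fun he => by
      have := hfar (Walk.nil.copy rfl he)
      simp at this
      omega
    have hadj : ¬ (graph σ).Adj p.1 q.1 := fun he => by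
      have := hfar he.toWalk
      simp at this
      omega
    have hpq : ∀ i, (σ (p.1, i)).1 ≠ q.1 := fun i hi =>
      hadj ((graph_adj h.invol).2 ⟨hne, i, hi⟩)
    have hqp : ∀ i, (σ (q.1, i)).1 ≠ p.1 := fun i hi =>
      hadj ((graph_adj h.invol).2 ⟨hne.symm, i, hi⟩).symm
    intro v i j
    simp only [link_apply h.invol hp hq]
    have := h.simple v i j
    grind

lemma unlink (h : IsPairing g σ) : IsPairing g (HalfEdge.link σ p (σ p)) := by
  have hle : graph (HalfEdge.link σ p (σ p)) ≤ graph σ := by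
    intro u v
    rw [graph_adj (unlink_involutive h.invol), graph_adj h.invol]
    simp only [unlink_apply h.invol]
    rintro ⟨huv, i, rfl⟩
    exact ⟨huv, i, by grind⟩
  refine ⟨unlink_involutive h.invol, fun v i j => ?_, h.girth.mono hle⟩
  simp only [unlink_apply h.invol]
  have h1 := h.simple v i j
  have h2 := h.fst_ne (p := (v, i))
  grind

lemma graph_unlink_le (h : IsPairing g σ) (hp : σ p ≠ p) :
    graph (HalfEdge.link σ p (σ p)) ≤ (graph σ).deleteEdges {s(p.1, (σ p).1)} := by
  intro u v
  rw [deleteEdges_adj, graph_adj (unlink_involutive h.invol), graph_adj h.invol,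
    Set.mem_singleton_iff, Sym2.eq_iff]
  simp only [unlink_apply h.invol]
  rintro ⟨huv, i, rfl⟩
  have h1 := h.simple p.1 p.2 i
  have h2 := h.simple (σ p).1 (σ p).2 i
  have h3 := h.invol p
  have h4 := h.fst_ne hp
  refine ⟨⟨huv, i, by grind⟩, ?_⟩
  grind

end IsPairing

end HalfEdge

namespace HalfEdge

open Finset Function CycleType

section Weight
variable {P ι A : Type*} [Fintype P] [DecidableEq P] [Fintype ι] [DecidableEq ι]
  {l : P → ι × Bool} {σ : P → P} {p q : P}

/-- The free half-edges. -/
def free (σ : P → P) : Finset P := {x | σ x = x}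

lemma mem_free : p ∈ free σ ↔ σ p = p := by simp [free]

lemma free_link (hσ : Involutive σ) (hp : p ∈ free σ) (hq : q ∈ free σ) (hpq : p ≠ q) :
    free (link σ p q) = ((free σ).erase p).erase q := by
  ext x
  rw [mem_free] at hp hq
  simp only [mem_erase, mem_free, link_apply hσ hp hq]
  grind

/-- A labelling of half-edges is compatible with a pairing if joined half-edges have opposite
labels. -/
def Compatible (l : P → ι × Bool) (σ : P → P) : Prop := ∀ x, σ x ≠ x → Fits (l x) (l (σ x))

instance : DecidablePred fun l : P → ι × Bool => Compatible l σ :=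
  fun _ => inferInstanceAs (Decidable (∀ _, _))

omit [Fintype ι] [DecidableEq ι] in
lemma compatible_link (hσ : Involutive σ) (hp : p ∈ free σ) (hq : q ∈ free σ) (hpq : p ≠ q) :
    Compatible l (link σ p q) ↔ Compatible l σ ∧ Fits (l p) (l q) := by
  rw [mem_free] at hp hq
  unfold Compatible Fits
  simp only [link_apply hσ hp hq]
  constructor
  · intro h
    refine ⟨fun x hx => ?_, by simpa [hpq.symm] using h p⟩
    have := hσ x
    have := h x
    grind
  · rintro ⟨h, h'⟩ x hx
    have := h x
    grind

/-- The total potential of the labellings compatible with a pairing. -/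
def weight (T : Finset A) (l : A → P → ι × Bool) (σ : P → P) : ℕ :=
  ∑ a ∈ T with Compatible (l a) σ, potential (l a) (free σ)

lemma sum_weight_link_le (T : Finset A) (l : A → P → ι × Bool) (hσ : Involutive σ)
    (hp : p ∈ free σ) : ∑ q ∈ (free σ).erase p, weight T l (link σ p q) ≤ weight T l σ := by
  have h : ∀ q ∈ (free σ).erase p, weight T l (link σ p q) = ∑ a ∈ T with Compatible (l a) σ,
      if Fits (l a p) (l a q) then potential (l a) (((free σ).erase p).erase q) else 0 := by
    intro q hq
    obtain ⟨hqp, hq⟩ := mem_erase.1 hq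
    unfold weight
    rw [free_link hσ hp hq hqp.symm, ← sum_filter, filter_filter]
    simp_rw [compatible_link hσ hp hq hqp.symm]
  rw [sum_congr rfl h, sum_comm]
  exact sum_le_sum fun a _ => sum_potential_erase_le (l a) hp

lemma weight_pos {T : Finset A} {l : A → P → ι × Bool} {a : A} (ha : a ∈ T)
    (h : Compatible (l a) σ) : 0 < weight T l σ :=
  sum_pos' (fun _ _ => Nat.zero_le _) ⟨a, mem_filter.2 ⟨ha, h⟩, potential_pos _ _⟩

open Nat in
lemma factorial_le_doubleFactorial_sq (n : ℕ) : n ! ≤ n‼ ^ 2 := by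
  have h : ∀ n : ℕ, n‼ ≤ (n + 1)‼ := by
    intro n
    induction n using Nat.twoStepInduction with
    | zero => rfl
    | one => decide
    | more n ih _ =>
      rw [doubleFactorial_add_two, doubleFactorial_add_two (n + 1)]
      exact Nat.mul_le_mul (by omega) ih
  cases n with
  | zero => rfl
  | succ n =>
    rw [factorial_eq_mul_doubleFactorial, sq]
    exact Nat.mul_le_mul_left _ (h n)

open Nat in
/-- Joining free half-edges greedily makes the weight small. -/
lemma exists_weight_le (T : Finset A) (l : A → P → ι × Bool) {Inv : (P → P) → Prop} {C : ℕ}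
    (hinv : ∀ σ, Inv σ → Involutive σ)
    (hstep : ∀ σ, Inv σ → C + 2 < #(free σ) → ∃ p ∈ free σ, ∃ B : Finset P, #B ≤ C ∧
      ∀ q ∈ free σ, q ≠ p → q ∉ B → Inv (link σ p q)) :
    ∀ n σ, #(free σ) = n → Inv σ → ∃ σ', Inv σ' ∧ #(free σ') ≤ C + 2 ∧
      weight T l σ' * (n - 1 - C)‼ ≤ weight T l σ := by
  intro n
  induction n using Nat.strong_induction_on with
  | _ n ih =>
    intro σ hn hσ
    rcases le_or_gt n (C + 2) with hle | hlt
    · refine ⟨σ, hσ, hn ▸ hle, ?_⟩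
      have : (n - 1 - C)‼ = 1 := by
        have : n - 1 - C = 0 ∨ n - 1 - C = 1 := by omega
        rcases this with h | h <;> rw [h] <;> rfl
      rw [this, mul_one]
    · obtain ⟨p, hp, B, hB, hgood⟩ := hstep σ hσ (hn ▸ hlt)
      have hcard : n - 1 - C ≤ #((free σ).erase p \ B) := by
        have h1 := le_card_sdiff B ((free σ).erase p)
        rw [card_erase_of_mem hp, hn] at h1
        omega
      obtain ⟨q, hq, hmin⟩ := exists_min_image ((free σ).erase p \ B) (fun q => weight T l (link σ p q))
        (card_pos.1 (by omega))
      have hw : weight T l (link σ p q) * (n - 1 - C) ≤ weight T l σ := calc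
        _ ≤ #((free σ).erase p \ B) • weight T l (link σ p q) := by
          rw [smul_eq_mul, mul_comm]
          exact Nat.mul_le_mul_right _ hcard
        _ ≤ ∑ q ∈ (free σ).erase p \ B, weight T l (link σ p q) := card_nsmul_le_sum _ _ _ hmin
        _ ≤ ∑ q ∈ (free σ).erase p, weight T l (link σ p q) :=
          sum_le_sum_of_subset sdiff_subset
        _ ≤ _ := sum_weight_link_le T l (hinv σ hσ) hp
      obtain ⟨hq, hqB⟩ := mem_sdiff.1 hq
      obtain ⟨hqp, hqf⟩ := mem_erase.1 hq
      have hcard' : #(free (link σ p q)) = n - 2 := by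
        rw [free_link (hinv σ hσ) hp hqf hqp.symm, card_erase_of_mem hq, card_erase_of_mem hp, hn]
        omega
      obtain ⟨σ', h1, h2, h3⟩ := ih (n - 2) (by omega) _ hcard' (hgood q hqf hqp hqB)
      refine ⟨σ', h1, h2, ?_⟩
      have : (n - 1 - C)‼ = (n - 2 - 1 - C)‼ * (n - 1 - C) := by
        obtain ⟨k, rfl⟩ := Nat.exists_eq_add_of_lt hlt
        rw [show C + 2 + k + 1 - 1 - C = k + 2 by omega,
          show C + 2 + k + 1 - 2 - 1 - C = k by omega, doubleFactorial_add_two, mul_comm]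
      rw [this, ← mul_assoc]
      exact (Nat.mul_le_mul_right _ h3).trans hw

end Weight

section Rooted
variable {V : Type*} {g : ℕ} {v₀ : V} {σ : V × Fin 3 → V × Fin 3}

/-- A pairing whose only non-trivial component contains `v₀` and has a free half-edge. -/
structure IsRooted [Fintype V] [DecidableEq V] (g : ℕ) (v₀ : V) (σ : V × Fin 3 → V × Fin 3) : Prop
    extends IsPairing g σ where
  reachable : ∀ p, σ p ≠ p → (graph σ).Reachable p.1 v₀
  exists_free : ∃ p ∈ free σ, (graph σ).Reachable p.1 v₀

lemma IsPairing.exists_ball [DecidableEq V] (h : IsPairing g σ) (k : ℕ) (u : V) :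
    ∃ B : Finset V, #B ≤ 4 ^ k ∧ ∀ v (w : (graph σ).Walk u v), w.length ≤ k → v ∈ B := by
  refine SimpleGraph.exists_ball (nb := fun v => univ.image fun i => (σ (v, i)).1)
    (fun v => card_image_le.trans (by simp)) (fun u v huv => ?_) k u
  obtain ⟨-, i, hi⟩ := (graph_adj h.invol).1 huv
  exact mem_image.2 ⟨i, mem_univ i, hi⟩

variable [Fintype V] [DecidableEq V]

lemma IsRooted.exists_link (h : IsRooted g v₀ σ) (hg : 3 ≤ g) :
    ∃ p ∈ free σ, ∃ B : Finset (V × Fin 3), #B ≤ 3 * 4 ^ g + 1 ∧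
      ∀ q ∈ free σ, q ≠ p → q ∉ B → IsRooted g v₀ (link σ p q) := by
  obtain ⟨p, hp, hpv⟩ := h.exists_free
  obtain ⟨B, hB, hmem⟩ := h.exists_ball g p.1
  have hlink : ∀ q ∈ free σ, q ≠ p → q.1 ∉ B →
      (∃ r ∈ free σ, r ≠ p ∧ r ≠ q ∧ (graph (link σ p q)).Reachable r.1 v₀) →
      IsRooted g v₀ (link σ p q) := by
    rintro q hq hqp hqB ⟨r, hr, hrp, hrq, hrv⟩
    have hgr := h.graph_link (mem_free.1 hp) (mem_free.1 hq)
    have hle : graph σ ≤ graph (link σ p q) := hgr ▸ le_sup_left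
    have hP := h.link hg (mem_free.1 hp) (mem_free.1 hq) fun w => by
      by_contra hw
      exact hqB (hmem _ w (by omega))
    have hpv' := hpv.mono hle
    have hpq : (graph (link σ p q)).Reachable q.1 v₀ := by
      have hadj := hP.adj (p := q) (by
        rw [link_apply h.invol (mem_free.1 hp) (mem_free.1 hq)]
        simp [hqp, hqp.symm])
      rw [link_apply h.invol (mem_free.1 hp) (mem_free.1 hq), if_neg hqp, if_pos rfl] at hadj
      exact hadj.reachable.trans hpv'
    refine ⟨hP, fun x hx => ?_, r, ?_, hrv⟩
    · rw [link_apply h.invol (mem_free.1 hp) (mem_free.1 hq)] at hx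
      by_cases hxp : x = p
      · exact hxp ▸ hpv'
      by_cases hxq : x = q
      · exact hxq ▸ hpq
      rw [if_neg hxp, if_neg hxq] at hx
      exact (h.reachable x hx).mono hle
    · rw [free_link h.invol hp hq hqp.symm]
      simp [hrp, hrq, hr]
  have hcard : #(B ×ˢ (univ : Finset (Fin 3))) ≤ 3 * 4 ^ g := by
    rw [card_product, Finset.card_univ, Fintype.card_fin, mul_comm]
    exact Nat.mul_le_mul_left _ hB
  have hle : ∀ q ∈ free σ, graph σ ≤ graph (link σ p q) := fun q hq => by
    rw [h.graph_link (mem_free.1 hp) (mem_free.1 hq)]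
    exact le_sup_left
  refine ⟨p, hp, ?_⟩
  by_cases hr : ∃ r ∈ free σ, r ≠ p ∧ (graph σ).Reachable r.1 v₀
  · obtain ⟨r, hr, hrp, hrv⟩ := hr
    refine ⟨insert r (B ×ˢ univ), (card_insert_le _ _).trans (by omega), fun q hq hqp hqB => ?_⟩
    rw [mem_insert, mem_product, not_or] at hqB
    exact hlink q hq hqp (fun hqB' => hqB.2 ⟨hqB', mem_univ _⟩)
      ⟨r, hr, hrp, Ne.symm hqB.1, hrv.mono (hle q hq)⟩
  · refine ⟨B ×ˢ univ, by omega, fun q hq hqp hqB => ?_⟩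
    rw [mem_product] at hqB
    have hqv : ¬ (graph σ).Reachable q.1 v₀ := fun hqv => hr ⟨q, hq, hqp, hqv⟩
    have hpq : p.1 ≠ q.1 := fun he => hqv (he ▸ hpv)
    obtain ⟨i, hi⟩ := exists_ne q.2
    refine hlink q hq hqp (fun hqB' => hqB ⟨hqB', mem_univ _⟩) ⟨(q.1, i), ?_, ?_, ?_, ?_⟩
    · rw [mem_free]
      by_contra hne
      exact hqv (h.reachable (q.1, i) hne)
    · exact fun he => hpq (by rw [← he])
    · exact fun he => hi (by rw [← he])
    · have hadj : (graph (link σ p q)).Adj q.1 p.1 := by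
        rw [h.graph_link (mem_free.1 hp) (mem_free.1 hq), SimpleGraph.sup_adj,
          SimpleGraph.edge_adj]
        exact Or.inr ⟨Or.inr ⟨rfl, rfl⟩, hpq.symm⟩
      exact hadj.reachable.trans (hpv.mono (hle q hq))

lemma isRooted_id (g : ℕ) (v₀ : V) : IsRooted g v₀ id where
  invol _ := rfl
  simple _ _ _ h := absurd rfl h
  girth u v h := by
    obtain ⟨hne, i, hi⟩ := (graph_adj fun _ => rfl).1 h
    exact absurd hi hne
  reachable _ h := absurd rfl h
  exists_free := ⟨(v₀, 0), mem_free.2 rfl, .rfl⟩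

lemma IsRooted.exists_reachable_free (h : IsRooted g v₀ σ) (v : V) :
    ∃ p ∈ free σ, (graph σ).Reachable v p.1 := by
  by_cases hv : (v, 0) ∈ free σ
  · exact ⟨_, hv, .rfl⟩
  · obtain ⟨p, hp, hpv⟩ := h.exists_free
    exact ⟨p, hp, (h.reachable _ (mt mem_free.2 hv)).trans hpv.symm⟩

end Rooted

section Final

lemma mem_balancedTypes {N K : ℕ} {σ : Fin N × Fin 3 → Fin N × Fin 3} (hσ : Involutive σ)
    {τ : Fin N → VType} (hK : #(free σ) ≤ K) (h : Compatible (slots τ) σ) :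
    τ ∈ balancedTypes N K := by
  have key : ∀ c b, slotCount (slots τ) univ (c, b) ≤ slotCount (slots τ) univ (c, !b) + K := by
    intro c b
    unfold slotCount
    refine le_trans ?_ (Nat.add_le_add_left hK _)
    rw [← card_filter_add_card_filter_not (s := {p | slots τ p = (c, b)})
      (fun p => σ p ≠ p)]
    refine Nat.add_le_add (card_le_card_of_injOn σ ?_ hσ.injective.injOn) (card_le_card ?_)
    · intro p hp
      simp only [coe_filter, mem_filter, mem_univ, true_and, Set.mem_ofPred_eq] at hp ⊢
      obtain ⟨h1, h2⟩ := h p hp.2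
      rw [hp.1] at h1 h2
      refine Prod.ext h1.symm ?_
      simpa using (Bool.eq_not_of_ne h2.symm)
    · intro p hp
      rw [mem_free]
      simpa using (mem_filter.1 hp).2
  exact mem_filter.2 ⟨mem_univ _, fun c => ⟨key c true, key c false⟩⟩

/-- There are pairings of large girth, with a free half-edge in every component, without
compatible labellings. -/
theorem exists_pairing_forall_not_compatible (g : ℕ) (hg : 3 ≤ g) :
    ∃ (N : ℕ) (σ : Fin N × Fin 3 → Fin N × Fin 3), IsPairing g σ ∧
      (∀ v, ∃ p, σ p = p ∧ (graph σ).Reachable v p.1) ∧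
      ∀ τ : Fin N → VType, ¬ Compatible (slots τ) σ := by
  obtain ⟨N, hN, hle, hlt⟩ := exists_sum_potential_lt (3 * 4 ^ g + 1) (3 * 4 ^ g + 1 + 2)
  obtain ⟨σ, hσ, hfree, hw⟩ := exists_weight_le (balancedTypes N (3 * 4 ^ g + 1 + 2)) slots
    (Inv := IsRooted g (⟨0, hN⟩ : Fin N)) (fun σ h => h.invol) (fun σ h _ => h.exists_link hg)
    (3 * N) id (by simp [free, mul_comm]) (isRooted_id g _)
  refine ⟨N, σ, hσ.toIsPairing, fun v => ?_, fun τ hτ => ?_⟩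
  · obtain ⟨p, hp, hvp⟩ := hσ.exists_reachable_free v
    exact ⟨p, mem_free.1 hp, hvp⟩
  · have hpos := weight_pos (l := slots) (mem_balancedTypes hσ.invol hfree hτ) hτ
    have hw0 : weight (balancedTypes N (3 * 4 ^ g + 1 + 2)) slots id =
        ∑ τ ∈ balancedTypes N (3 * 4 ^ g + 1 + 2), potential (slots τ) univ := by
      have : free (id : Fin N × Fin 3 → _) = univ := by simp [free]
      rw [weight, this, filter_true_of_mem fun τ _ x hx => absurd rfl hx]
    rw [hw0] at hw
    have h1 := (Nat.le_mul_of_pos_left _ hpos).trans hw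
    have h2 := (factorial_le_doubleFactorial_sq _).trans (Nat.pow_le_pow_left h1 2)
    omega

end Final

end HalfEdge

namespace HalfEdge

open Finset Function SimpleGraph

variable {V : Type*} {g : ℕ} {σ : V × Fin 3 → V × Fin 3}

lemma even_card_free {P : Type*} [Fintype P] [DecidableEq P] {σ : P → P} (hσ : Involutive σ)
    (hP : Even (Fintype.card P)) : Even #(free σ) := by
  have h1 : 2 ∣ #hσ.toPerm.support := Equiv.Perm.two_dvd_card_support (by
    ext x
    simp [sq, hσ x])
  have h2 : hσ.toPerm.support = ({x | ¬ σ x = x} : Finset P) := by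
    ext x
    simp
  have h3 := card_filter_add_card_filter_not (s := (univ : Finset P)) fun x => σ x = x
  rw [h2] at h1
  rw [Finset.card_univ] at h3
  unfold free
  grind

/-- Add vertices all of whose half-edges are free. -/
def extend {W : Type*} (σ : V × Fin 3 → V × Fin 3) : (V ⊕ W) × Fin 3 → (V ⊕ W) × Fin 3
  | (.inl v, i) => (.inl (σ (v, i)).1, (σ (v, i)).2)
  | (.inr w, i) => (.inr w, i)

lemma IsPairing.extend {W : Type*} (h : IsPairing g σ) : IsPairing g (extend (W := W) σ) := by
  have hinv : Involutive (HalfEdge.extend (W := W) σ) := by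
    rintro ⟨v | w, i⟩
    · simp [HalfEdge.extend, h.invol (v, i)]
    · rfl
  refine ⟨hinv, ?_, ?_⟩
  · rintro (v | w) i j h1 h2
    · have := h.simple v i j
      simp only [HalfEdge.extend, ne_eq, Prod.ext_iff, Sum.inl.injEq] at h1 h2 this
      exact this h1 h2
    · exact absurd rfl h1
  · have hadj : ∀ x y, (graph (HalfEdge.extend (W := W) σ)).Adj x y →
        ∃ u v, x = .inl u ∧ y = .inl v ∧ (graph σ).Adj u v := by
      intro x y hxy
      obtain ⟨hne, i, rfl⟩ := (graph_adj hinv).1 hxy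
      rcases x with u | w
      · exact ⟨u, _, rfl, rfl, (graph_adj h.invol).2 ⟨fun he => hne (congrArg _ he), i, rfl⟩⟩
      · exact absurd rfl hne
    intro x y hxy w
    obtain ⟨u, v, rfl, rfl, huv⟩ := hadj x y hxy
    let f : (graph (HalfEdge.extend (W := W) σ)).deleteEdges {s(.inl u, .inl v)} →g
        (graph σ).deleteEdges {s(u, v)} :=
      { toFun := Sum.elim id fun _ => u
        map_rel' := by
          intro a b hab
          rw [deleteEdges_adj] at hab
          obtain ⟨a, b, rfl, rfl, h'⟩ := hadj a b hab.1
          rw [deleteEdges_adj]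
          refine ⟨h', fun he => hab.2 ?_⟩
          simpa [Sym2.eq_iff] using he }
    have := h.girth huv (w.map f)
    exact this.trans_eq (congrArg (· + 1) (Walk.length_map f w))

/-- Replace a pair `{x, σ x}` far away from two free half-edges `p` and `q` by `{p, x}` and
`{q, σ x}`. -/
lemma IsPairing.exists_exchange [Fintype V] [DecidableEq V] (h : IsPairing g σ) (hg : 3 ≤ g)
    {p q x : V × Fin 3} (hp : σ p = p) (hq : σ q = q) (hpq : p ≠ q) (hx : σ x ≠ x)
    (hfar : ∀ w : (graph σ).Walk p.1 x.1, 2 * g < w.length) (w₀ : (graph σ).Walk p.1 q.1)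
    (hw₀ : w₀.length + 1 < g) :
    ∃ σ', IsPairing g σ' ∧ free σ' ⊆ free σ ∧ p ∉ free σ' ∧
      ∀ z, σ z ≠ z → z ≠ x → z ≠ σ x → σ' z = σ z := by
  have hyx : σ (σ x) = x := h.invol x
  have hxy := h.adj hx
  have happ₂ := unlink_apply (p := x) h.invol
  have hle₂ := h.graph_unlink_le hx
  have h₂ := h.unlink (p := x)
  have hinv := h.invol
  generalize σ x = y at *
  have hxy' : σ x = y := by rw [← hyx, hinv]
  have hle₂' := hle₂.trans (deleteEdges_le _)
  generalize link σ x y = σ₂ at *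
  have hp₂ : σ₂ p = p := by grind
  have hx₂ : σ₂ x = x := by grind
  have happ₃ := link_apply h₂.invol hp₂ hx₂
  have hgr₃ := h₂.graph_link hp₂ hx₂
  have h₃ : IsPairing g (link σ₂ p x) := h₂.link hg hp₂ hx₂ fun w' => by
    have := hfar (w'.mapLe hle₂')
    rw [Walk.length_mapLe] at this
    omega
  generalize link σ₂ p x = σ₃ at *
  have hq₃ : σ₃ q = q := by grind
  have hy₃ : σ₃ y = y := by grind
  have happ₄ := link_apply h₃.invol hq₃ hy₃
  have h₄ : IsPairing g (link σ₃ q y) := h₃.link hg hq₃ hy₃ <| by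
    rw [hgr₃]
    intro w
    rcases w.exists_of_sup_edge with ⟨w', hw⟩ | ⟨w₁, w₂, hw⟩ | ⟨w₁, w₂, hw⟩
    · have := hfar ((w₀.append (w'.mapLe hle₂')).concat hxy.symm)
      simp only [Walk.length_concat, Walk.length_append, Walk.length_mapLe] at this
      omega
    · have := h.girth hxy (w₂.mapLe hle₂)
      rw [Walk.length_mapLe] at this
      omega
    · have := hfar (w₀.append (w₁.mapLe hle₂'))
      rw [Walk.length_append, Walk.length_mapLe] at this
      omega
  refine ⟨_, h₄, fun z => ?_, ?_, fun z => ?_⟩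
  · rw [mem_free, mem_free]
    grind
  · rw [mem_free]
    grind
  · grind

/-- Every pairing extends to a pairing without free half-edges, on more vertices. -/
theorem IsPairing.exists_complete [Fintype V] [DecidableEq V] (h : IsPairing g σ) (hg : 3 ≤ g) :
    ∃ (n : ℕ) (σ' : (V ⊕ Fin n) × Fin 3 → (V ⊕ Fin n) × Fin 3), IsPairing g σ' ∧
      (∀ p, σ' p ≠ p) ∧ ∀ v i, σ (v, i) ≠ (v, i) →
        σ' (.inl v, i) = (.inl (σ (v, i)).1, (σ (v, i)).2) := by
  set n := Fintype.card V + 2 * 4 ^ (2 * g + 2) with hn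
  let S : Set ((V ⊕ Fin n) × Fin 3 → (V ⊕ Fin n) × Fin 3) := {σ' | IsPairing g σ' ∧
    ∀ v i, σ (v, i) ≠ (v, i) → σ' (.inl v, i) = (.inl (σ (v, i)).1, (σ (v, i)).2)}
  obtain ⟨σ', ⟨hσ', hext⟩, hmin⟩ := Set.exists_min_image S (fun σ' => #(free σ')) S.toFinite
    ⟨_, h.extend, fun _ _ _ => rfl⟩
  refine ⟨n, σ', hσ', fun p hp => ?_, hext⟩
  have hmin' : ∀ σ₂, IsPairing g σ₂ → free σ₂ ⊆ free σ' → p ∉ free σ₂ →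
      ∃ v i, σ (v, i) ≠ (v, i) ∧ σ₂ (.inl v, i) ≠ σ' (.inl v, i) := by
    intro σ₂ h₂ hsub hp₂
    by_contra! hcon
    refine (hmin σ₂ ⟨h₂, fun v i hv => (hcon v i hv).trans (hext v i hv)⟩).not_gt
      (card_lt_card ⟨hsub, fun hsup => hp₂ (hsup (mem_free.2 hp))⟩)
  have hnotfree : ∀ v i, σ (v, i) ≠ (v, i) → σ' (.inl v, i) ≠ (.inl v, i) := by
    intro v i hv he
    rw [hext v i hv] at he
    simp only [Prod.mk.injEq, Sum.inl.injEq] at he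
    exact hv (Prod.ext he.1 he.2)
  have hnear : ∀ q, σ' q = q → p ≠ q → ∃ w : (graph σ').Walk p.1 q.1, w.length + 1 < g := by
    intro q hq hpq
    by_contra! hfar
    have happ := link_apply hσ'.invol hp hq
    obtain ⟨v, i, hv, hne⟩ := hmin' _ (hσ'.link hg hp hq hfar)
      (by rw [free_link hσ'.invol (mem_free.2 hp) (mem_free.2 hq) hpq]; grind)
      (by rw [free_link hσ'.invol (mem_free.2 hp) (mem_free.2 hq) hpq]; simp)
    have := hnotfree v i hv
    rw [happ] at hne
    grind
  obtain ⟨B, hB, hmem⟩ := hσ'.exists_ball (2 * g + 2) p.1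
  obtain ⟨w, hw⟩ : ∃ w : Fin n, Sum.inr w ∉ B := by
    by_contra! hall
    have h1 := card_le_card_of_injOn (s := univ) (t := B) (Sum.inr : Fin n → V ⊕ Fin n)
      (fun w _ => hall w) Sum.inr_injective.injOn
    rw [Finset.card_univ, Fintype.card_fin] at h1
    have : 0 < 4 ^ (2 * g + 2) := by positivity
    omega
  set x : (V ⊕ Fin n) × Fin 3 := (.inr w, 0) with hx
  have hfar : ∀ w' : (graph σ').Walk p.1 x.1, 2 * g + 2 < w'.length := fun w' => by
    by_contra! hle
    exact hw (hmem _ w' hle)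
  have hpx1 : p.1 ≠ x.1 := fun he => by
    have := hfar (Walk.nil.copy rfl he)
    simp at this
  have hpx : p ≠ x := fun he => hpx1 (by rw [← he])
  have hx' : σ' x ≠ x := fun hx' => by
    obtain ⟨w', hw'⟩ := hnear x hx' hpx
    have := hfar w'
    omega
  obtain ⟨q, hq, hqp⟩ : ∃ q, σ' q = q ∧ q ≠ p := by
    have heven : Even #(free σ') := even_card_free hσ'.invol (by
      simp only [Fintype.card_prod, Fintype.card_sum, Fintype.card_fin, hn]
      grind)
    have hpos : 0 < #(free σ') := card_pos.2 ⟨p, mem_free.2 hp⟩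
    obtain ⟨q, hq, hqp⟩ := exists_mem_ne (show 1 < #(free σ') by grind) p
    exact ⟨q, mem_free.1 hq, hqp⟩
  obtain ⟨w₀, hw₀⟩ := hnear q hq hqp.symm
  obtain ⟨σ₂, h₂, hsub, hp₂, heq⟩ := hσ'.exists_exchange hg hp hq hqp.symm hx'
    (fun w' => by have := hfar w'; omega) w₀ hw₀
  obtain ⟨v, i, hv, hne⟩ := hmin' σ₂ h₂ hsub hp₂
  refine hne (heq _ (hnotfree v i hv) (by rw [hx]; simp) fun he => ?_)
  have h5 := hext v i hv
  rw [he, hσ'.invol] at h5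
  simp [hx] at h5

end HalfEdge

section SevenCycle

open Finset Function SimpleGraph

/-- `f` is a homomorphism to the cycle `C₇`. -/
def SimpleGraph.IsSevenCycleHom {V : Type*} (G : SimpleGraph V) (f : V → ZMod 7) : Prop :=
  ∀ ⦃u v⦄, G.Adj u v → f v = f u + 1 ∨ f u = f v + 1

lemma SimpleGraph.IsCircularColoring.exists_isSevenCycleHom {V : Type*} {G : SimpleGraph V}
    {n k : ℕ} (hn : 0 < n) (hk : 3 * n < 7 * k) (h : G.IsCircularColoring n k) :
    ∃ f, G.IsSevenCycleHom f := by
  have : NeZero n := ⟨hn.ne'⟩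
  obtain ⟨f, hf⟩ := h
  have key : ∀ a b : ZMod n, b.val ≤ a.val → k ≤ (a - b).val → (a - b).val ≤ n - k →
      (2 * ((7 * b.val / n : ℕ) : ZMod 7) = 2 * ((7 * a.val / n : ℕ) : ZMod 7) + 1 ∨
        2 * ((7 * a.val / n : ℕ) : ZMod 7) = 2 * ((7 * b.val / n : ℕ) : ZMod 7) + 1) := by
    intro a b hle h1 h2
    rw [ZMod.val_sub hle] at h1 h2
    have h3 : 7 * b.val / n * n ≤ 7 * b.val := Nat.div_mul_le_self _ _
    have h4 : 7 * b.val < (7 * b.val / n + 1) * n := by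
      rw [mul_comm _ n]
      exact Nat.lt_mul_div_succ _ hn
    have h5 : 7 * a.val / n = 7 * b.val / n + 3 ∨ 7 * a.val / n = 7 * b.val / n + 4 := by
      have h6 : 7 * b.val / n + 3 ≤ 7 * a.val / n := by
        rw [Nat.le_div_iff_mul_le hn, add_mul]
        omega
      have h7 : 7 * a.val / n < 7 * b.val / n + 5 := by
        rw [Nat.div_lt_iff_lt_mul hn, add_mul]
        rw [add_mul] at h4
        omega
      omega
    rcases h5 with h5 | h5 <;> rw [h5] <;> push_cast <;>
      generalize ((7 * b.val / n : ℕ) : ZMod 7) = c <;> revert c <;> decide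
  refine ⟨fun v => 2 * ((7 * (f v).val / n : ℕ) : ZMod 7), fun u v huv => ?_⟩
  rcases le_total (f v).val (f u).val with hle | hle
  · exact key _ _ hle (hf u v huv).1 (hf u v huv).2
  · exact (key _ _ hle (hf v u huv.symm).1 (hf v u huv.symm).2).symm

/-- A homomorphism to `C₇` can be changed so that every vertex outside of a given set meeting all
components has a neighbour of the preceding colour. -/
lemma SimpleGraph.IsSevenCycleHom.exists_canonical {V : Type*} [Fintype V] {G : SimpleGraph V}
    {R : Set V} (hR : ∀ v, ∃ r ∈ R, G.Reachable v r) {f : V → ZMod 7} (hf : G.IsSevenCycleHom f) :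
    ∃ f', G.IsSevenCycleHom f' ∧ ∀ v ∉ R, ∃ u, G.Adj v u ∧ f' v = f' u + 1 := by
  classical
  let S : Set (V → ℕ) := {s | (∀ v ∈ R, s v = 0) ∧
    ∀ u v, G.Adj u v → f v = f u + 1 → s v ≤ s u ∧ s u ≤ s v + 1}
  choose r hr hreach using hR
  have hbound : ∀ s ∈ S, ∀ v, s v ≤ (hreach v).some.length := by
    intro s hs v
    have hwalk : ∀ a b (w : G.Walk a b), s a ≤ s b + w.length := by
      intro a b w
      induction w with
      | nil => simp
      | cons h p ih =>
        rw [Walk.length_cons]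
        rcases hf h with h' | h'
        · have := hs.2 _ _ h h'
          omega
        · have := hs.2 _ _ h.symm h'
          omega
    simpa [hs.1 _ (hr v)] using hwalk v (r v) (hreach v).some
  have hfin : S.Finite := (Set.finite_Iic fun v => (hreach v).some.length).subset hbound
  obtain ⟨s, hs, hmax⟩ := Set.exists_max_image S (fun s => ∑ v, s v) hfin
    ⟨0, fun _ _ => rfl, fun _ _ _ _ => by simp⟩
  have key : ∀ u v, G.Adj u v → f v = f u + 1 →
      s u = s v ∧ f v + 2 * s v = f u + 2 * s u + 1 ∨
      s u = s v + 1 ∧ f u + 2 * s u = f v + 2 * s v + 1 := by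
    intro u v huv h
    have h1 := hs.2 u v huv h
    have h2 : s u = s v ∨ s u = s v + 1 := by omega
    rcases h2 with h2 | h2
    · refine Or.inl ⟨h2, ?_⟩
      rw [h2, h]
      ring
    · refine Or.inr ⟨h2, ?_⟩
      rw [h2, h]
      push_cast
      ring
  refine ⟨fun v => f v + 2 * s v, fun u v huv => ?_, fun v hv => ?_⟩
  · rcases hf huv with h | h
    · exact (key u v huv h).imp And.right And.right
    · exact (key v u huv.symm h).symm.imp And.right And.right
  · by_contra! hcon
    have hmem : update s v (s v + 1) ∈ S := by
      refine ⟨fun x hx => ?_, fun a b hab h => ?_⟩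
      · rw [update_of_ne fun he => hv (by rwa [← he]), hs.1 x hx]
      · have h1 := hs.2 a b hab h
        have h2 := key a b hab h
        have h3 := hcon a
        have h4 := hcon b
        have hne := hab.ne
        by_cases hav : a = v
        · subst hav
          rw [update_self, update_of_ne hne.symm]
          have := h4 hab
          grind
        · rw [update_of_ne hav]
          by_cases hbv : b = v
          · subst hbv
            rw [update_self]
            have := h3 hab.symm
            grind
          · rwa [update_of_ne hbv]
    have hle := hmax _ hmem
    rw [sum_update_of_mem (mem_univ v), sdiff_singleton_eq_erase,
      ← add_sum_erase _ _ (mem_univ v)] at hle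
    omega

end SevenCycle

namespace HalfEdge

open CycleType SimpleGraph

lemma IsPairing.exists_compatible {N g : ℕ} {σ : Fin N × Fin 3 → Fin N × Fin 3}
    (h : IsPairing g σ) (hfree : ∀ v, ∃ p, σ p = p ∧ (graph σ).Reachable v p.1)
    {f : Fin N → ZMod 7} (hf : (graph σ).IsSevenCycleHom f) :
    ∃ τ : Fin N → VType, Compatible (slots τ) σ := by
  obtain ⟨f, hf, hdown⟩ := hf.exists_canonical (R := {v | ∃ i, σ (v, i) = (v, i)}) fun v => by
    obtain ⟨p, hp, hvp⟩ := hfree v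
    exact ⟨p.1, ⟨p.2, hp⟩, hvp⟩
  have htwo : ∀ a : ZMod 7, a ≠ a + 1 + 1 := by decide
  have hself : ∀ a : ZMod 7, a ≠ a + 1 := by decide
  have hτ : ∀ v, ∃ t : VType, t.1 = (f v, fun i => decide (f (σ (v, i)).1 = f v + 1)) := by
    intro v
    by_cases hv : ∃ i, σ (v, i) = (v, i)
    · obtain ⟨i, hi⟩ := hv
      exact ⟨⟨_, i, by rw [decide_eq_false_iff_not, hi]; exact hself _⟩, rfl⟩
    · obtain ⟨u, huv, hu⟩ := hdown v hv
      obtain ⟨-, i, rfl⟩ := (graph_adj h.invol).1 huv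
      exact ⟨⟨_, i, by rw [decide_eq_false_iff_not, hu]; exact htwo _⟩, rfl⟩
  choose τ hτ using hτ
  have hslot : ∀ y, slots τ y =
      if f (σ y).1 = f y.1 + 1 then (f y.1, true) else (f y.1 - 1, false) := by
    intro y
    simp only [slots, label, hτ, slot, Equiv.coe_fn_mk, Prod.mk.eta]
    split_ifs <;> simp_all
  refine ⟨τ, fun x hx => ?_⟩
  rw [hslot, hslot, h.invol x]
  unfold Fits
  rcases hf (h.adj hx) with h1 | h1 <;> simp [h1, htwo]

end HalfEdge

theorem cubic_large_girth_circular_chromatic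
    (g : ℕ) (hg : 0 < g) :
    ∃ (m : ℕ) (G : SimpleGraph (Fin m)),
      (∀ v : Fin m, (G.neighborSet v).ncard = 3) ∧ (g : ℕ∞) ≤ G.egirth ∧
      (7 / 3 : ℝ) ≤ G.circChromNum := by
  obtain ⟨N, σ, hσ, hfree, hσ'⟩ := HalfEdge.exists_pairing_forall_not_compatible (max g 3) (le_max_right _ _)
  obtain ⟨n, σ', h', hnf, hext⟩ := hσ.exists_complete (le_max_right _ _)
  let e := Fintype.equivFin (Fin N ⊕ Fin n)
  let φ : (HalfEdge.graph σ').comap e.symm ≃g HalfEdge.graph σ' := Iso.comap e.symm _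
  refine ⟨_, (HalfEdge.graph σ').comap e.symm, fun v => ?_, ?_, ?_⟩
  · have h1 : (HalfEdge.graph σ').neighborSet (e.symm v) = Set.range fun i => (σ' (e.symm v, i)).1 := by
      ext u
      rw [mem_neighborSet, HalfEdge.graph_adj h'.invol, Set.mem_range]
      refine and_iff_right_of_imp ?_
      rintro ⟨i, rfl⟩
      exact (h'.fst_ne (hnf (e.symm v, i))).symm
    have h2 : Function.Injective fun i => (σ' (e.symm v, i)).1 :=
      fun i j hij => h'.simple _ i j (hnf _) hij
    rw [← Nat.card_coe_set_eq, Nat.card_congr (φ.mapNeighborSet v)]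
    change Nat.card ((HalfEdge.graph σ').neighborSet (e.symm v)) = 3
    rw [h1, Nat.card_range_of_injective h2, Nat.card_eq_fintype_card, Fintype.card_fin]
  · rw [φ.egirth_eq]
    exact le_trans (by exact_mod_cast le_max_left _ _) h'.girth.natCast_le_egirth
  · refine le_csInf ⟨_, Fintype.card (Fin N ⊕ Fin n) + 1, 1, by omega, one_pos, ?_, rfl⟩ ?_
    · refine ⟨fun v => ((v : ℕ) : ZMod (Fintype.card (Fin N ⊕ Fin n) + 1)), fun u v huv => ⟨?_, ?_⟩⟩
      · rw [Nat.one_le_iff_ne_zero, ne_eq, ZMod.val_eq_zero, sub_eq_zero,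
          ZMod.natCast_eq_natCast_iff', Nat.mod_eq_of_lt (by omega), Nat.mod_eq_of_lt (by omega)]
        exact fun he => huv.ne (Fin.ext he)
      · exact Nat.le_of_lt_succ (ZMod.val_lt _)
    · rintro x ⟨a, b, ha, hb, hcol, rfl⟩
      by_contra! hlt
      have hb' : (0 : ℝ) < b := Nat.cast_pos.2 hb
      rw [div_lt_div_iff₀ hb' three_pos] at hlt
      have hlt' : a * 3 < 7 * b := by exact_mod_cast hlt
      obtain ⟨f, hf⟩ := hcol.exists_isSevenCycleHom ha (by omega)
      have hhom : (HalfEdge.graph σ).IsSevenCycleHom fun v => f (e (.inl v)) := by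
        intro u v huv
        refine hf ?_
        obtain ⟨hne, i, rfl⟩ := (HalfEdge.graph_adj hσ.invol).1 huv
        rw [comap_adj, e.symm_apply_apply, e.symm_apply_apply, HalfEdge.graph_adj h'.invol]
        refine ⟨Sum.inl_injective.ne hne, i, ?_⟩
        rw [hext u i fun he => hne (by rw [he])]
      obtain ⟨τ, hτ⟩ := hσ.exists_compatible hfree hhom
      exact hσ' τ hτ
end

section
/- For every positive integer p there exists an integer N such that for all n ≥ N, the path P_n on n vertices satisfies χ_p(P_n) = p + 1. Consequently, the bound in the statement 'every graph of sufficiently large girth in a proper minor-closed class has χ_p at most p + 2' cannot be improved below p + 1. -/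
open SimpleGraph ENNReal

universe u

namespace SimpleGraph

/-- `lt` is the strict ancestor relation of a rooted forest of height at most `k` on the
vertices of `G`, in whose closure `G` is contained. -/
def IsForestOrder {V : Type*} (G : SimpleGraph V) (k : ℕ) (lt : V → V → Prop) : Prop :=
  Transitive lt ∧ Irreflexive lt ∧
    (∀ x y z, lt x z → lt y z → (lt x y ∨ lt y x ∨ x = y)) ∧
    (∀ u v, G.Adj u v → lt u v ∨ lt v u) ∧
    (∀ s : Finset V, (∀ x ∈ s, ∀ y ∈ s, x = y ∨ lt x y ∨ lt y x) → s.card ≤ k)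

theorem IsForestOrder.treeDepth_le {V : Type*} [Fintype V] {G : SimpleGraph V} {k : ℕ}
    {lt : V → V → Prop} (h : G.IsForestOrder k lt) : G.treeDepth ≤ k :=
  Nat.sInf_le ⟨lt, h⟩

theorem exists_isForestOrder_treeDepth {V : Type*} [Fintype V] (G : SimpleGraph V) :
    ∃ lt, G.IsForestOrder G.treeDepth lt := by
  refine Nat.sInf_mem (s := {k | ∃ lt, G.IsForestOrder k lt}) ⟨Fintype.card V, ?_⟩
  let e := Fintype.equivFin V
  refine ⟨fun u v => e u < e v, fun _ _ _ => lt_trans, fun _ => lt_irrefl _,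
    fun x y _ _ _ => ?_, fun u v huv => ?_, fun s _ => s.card_le_univ⟩
  · rcases lt_trichotomy (e x) (e y) with h | h | h
    · exact .inl h
    · exact .inr (.inr (e.injective h))
    · exact .inr (.inl h)
  · exact lt_or_gt_of_ne (e.injective.ne huv.ne)

theorem treeDepth_le_of_injective {V W : Type*} [Fintype V] [Fintype W] {G : SimpleGraph V}
    {H : SimpleGraph W} (f : G →g H) (hf : Function.Injective f) :
    G.treeDepth ≤ H.treeDepth := by
  obtain ⟨lt, htrans, hirr, htree, hadj, hcard⟩ := H.exists_isForestOrder_treeDepth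
  refine IsForestOrder.treeDepth_le (lt := fun u v => lt (f u) (f v))
    ⟨fun _ _ _ => @htrans _ _ _, fun _ => hirr _, fun x y z hx hy => ?_,
      fun u v h => hadj _ _ (f.map_rel h), fun s hs => ?_⟩
  · simpa only [hf.eq_iff] using htree _ _ _ hx hy
  · rw [← Finset.card_map ⟨f, hf⟩]
    refine hcard _ ?_
    simp only [Finset.forall_mem_map, Function.Embedding.coeFn_mk, hf.eq_iff]
    exact hs

/-- If consecutive integers of an interval are comparable in a forest order, then one of its
elements is an ancestor of all the others. -/
theorem exists_root_of_interval {R : ℕ → ℕ → Prop} (htrans : Transitive R)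
    (htree : ∀ x y z, R x z → R y z → (R x y ∨ R y x ∨ x = y)) (a m : ℕ)
    (hadj : ∀ i, a ≤ i → i < a + m → R i (i + 1) ∨ R (i + 1) i) :
    ∃ r, a ≤ r ∧ r ≤ a + m ∧ ∀ i, a ≤ i → i ≤ a + m → r = i ∨ R r i := by
  induction m with
  | zero => exact ⟨a, le_rfl, le_rfl, fun i h₁ h₂ => .inl (by omega)⟩
  | succ m ih =>
    obtain ⟨r, har, hrm, hr⟩ := ih fun i h₁ h₂ => hadj i h₁ (by omega)
    by_cases h : R r (a + m + 1)
    · refine ⟨r, har, by omega, fun i h₁ h₂ => ?_⟩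
      rcases Nat.lt_or_ge (a + m) i with hi | hi
      · obtain rfl : i = a + m + 1 := by omega
        exact .inr h
      · exact hr i h₁ hi
    · have hlast : R (a + m + 1) r := by
        rcases hadj (a + m) (by omega) (by omega) with h₁ | h₁ <;>
          rcases hr (a + m) (by omega) le_rfl with h₂ | h₂
        · exact absurd (h₂ ▸ h₁) h
        · exact absurd (htrans h₂ h₁) h
        · exact h₂ ▸ h₁
        · rcases htree _ _ _ h₁ h₂ with h₃ | h₃ | h₃
          · exact h₃
          · exact absurd h₃ h
          · omega
      refine ⟨a + m + 1, by omega, by omega, fun i h₁ h₂ => ?_⟩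
      rcases Nat.lt_or_ge (a + m) i with hi | hi
      · exact .inl (by omega)
      · rcases hr i h₁ hi with rfl | h₃
        · exact .inr hlast
        · exact .inr (htrans hlast h₃)

/-- If consecutive integers of an interval with at least `2 ^ k` elements are comparable in a
forest order, then the interval contains a chain of `k + 1` elements. -/
theorem exists_chain_of_interval {R : ℕ → ℕ → Prop} (htrans : Transitive R)
    (htree : ∀ x y z, R x z → R y z → (R x y ∨ R y x ∨ x = y)) (k a m : ℕ)
    (hm : 2 ^ k ≤ m + 1) (hadj : ∀ i, a ≤ i → i < a + m → R i (i + 1) ∨ R (i + 1) i) :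
    ∃ s ⊆ Finset.Icc a (a + m), s.card = k + 1 ∧
      ∀ x ∈ s, ∀ y ∈ s, x = y ∨ R x y ∨ R y x := by
  induction k generalizing a m with
  | zero => exact ⟨{a}, by simp, by simp, by simp⟩
  | succ k ih =>
    obtain ⟨r, har, hrm, hr⟩ := exists_root_of_interval htrans htree a m hadj
    rw [pow_succ] at hm
    have hpos := Nat.one_le_two_pow (n := k)
    obtain ⟨b, l, hl, hab, hbl, hrb⟩ : ∃ b l, 2 ^ k ≤ l + 1 ∧ a ≤ b ∧ b + l ≤ a + m ∧
        r ∉ Finset.Icc b (b + l) := by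
      simp only [Finset.mem_Icc]
      rcases Nat.lt_or_ge r (a + 2 ^ k) with h | h
      · exact ⟨r + 1, a + m - (r + 1), by omega, by omega, by omega, by omega⟩
      · exact ⟨a, 2 ^ k - 1, by omega, by omega, by omega, by omega⟩
    obtain ⟨s, hs, hcard, hchain⟩ := ih b l hl fun i h₁ h₂ => hadj i (by omega) (by omega)
    have hroot : ∀ x ∈ s, R r x := fun x hx => by
      have hx' := Finset.mem_Icc.1 (hs hx)
      refine (hr x (by omega) (by omega)).resolve_left ?_
      rintro rfl
      exact hrb (hs hx)
    refine ⟨insert r s, ?_, ?_, ?_⟩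
    · refine Finset.insert_subset (Finset.mem_Icc.2 ⟨har, hrm⟩) (hs.trans ?_)
      exact Finset.Icc_subset_Icc hab hbl
    · rw [Finset.card_insert_of_notMem fun h => hrb (hs h), hcard]
    · simp only [Finset.forall_mem_insert]
      exact ⟨⟨.inl trivial, fun x hx => .inr (.inl (hroot x hx))⟩,
        fun x hx => ⟨.inr (.inr (hroot x hx)), hchain x hx⟩⟩

theorem lt_treeDepth_pathGraph {k n : ℕ} (h : 2 ^ k ≤ n) : k < (pathGraph n).treeDepth := by
  obtain ⟨lt, htrans, -, htree, hadj, hcard⟩ := (pathGraph n).exists_isForestOrder_treeDepth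
  have hn : 0 < n := (Nat.two_pow_pos k).trans_le h
  let R : ℕ → ℕ → Prop := fun i j => ∃ (hi : i < n) (hj : j < n), lt ⟨i, hi⟩ ⟨j, hj⟩
  obtain ⟨s, hs, hsc, hchain⟩ := exists_chain_of_interval (R := R)
    (fun _ _ _ ⟨hi, _, h₁⟩ ⟨_, hl, h₂⟩ => ⟨hi, hl, htrans h₁ h₂⟩)
    (fun x y z ⟨hx, _, h₁⟩ ⟨hy, _, h₂⟩ => by
      rcases htree _ _ _ h₁ h₂ with h₃ | h₃ | h₃
      · exact .inl ⟨hx, hy, h₃⟩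
      · exact .inr (.inl ⟨hy, hx, h₃⟩)
      · exact .inr (.inr (Fin.mk.inj h₃)))
    k 0 (n - 1) (by omega) fun i _ hi => by
      rcases hadj ⟨i, by omega⟩ ⟨i + 1, by omega⟩ (by simp [pathGraph_adj]) with h₁ | h₁
      · exact .inl ⟨_, _, h₁⟩
      · exact .inr ⟨_, _, h₁⟩
  have hlt : ∀ x ∈ s, x < n := fun x hx => by
    have := Finset.mem_Icc.1 (hs hx)
    omega
  have := hcard (s.attachFin hlt) fun x hx y hy => by
    rw [Finset.mem_attachFin] at hx hy
    rcases hchain _ hx _ hy with h₁ | ⟨_, _, h₁⟩ | ⟨_, _, h₁⟩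
    · exact .inl (Fin.ext h₁)
    · exact .inr (.inl h₁)
    · exact .inr (.inr h₁)
  rw [Finset.card_attachFin] at this
  omega

/-- Colouring a path periodically with `p + 1` colors, any set of at most `p` color classes
induces a subgraph whose tree-depth is at most the number of classes. -/
theorem treeDepth_induce_pathGraph_le {n p : ℕ} (s : Finset (Fin (p + 1))) (hs : s.card ≤ p)
    [Fintype {v : Fin n | Fin.ofNat (p + 1) v.1 ∈ s}] :
    ((pathGraph n).induce {v : Fin n | Fin.ofNat (p + 1) v.1 ∈ s}).treeDepth ≤ s.card := by
  let lt (u v : {v : Fin n | Fin.ofNat (p + 1) v.1 ∈ s}) : Prop :=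
    u.1.1 < v.1.1 ∧ ∀ w, u.1.1 ≤ w → w ≤ v.1.1 → Fin.ofNat (p + 1) w ∈ s
  have hne : ∀ u v, lt u v → Fin.ofNat (p + 1) u.1 ≠ Fin.ofNat (p + 1) v.1 := by
    rintro u v ⟨huv, hw⟩ heq
    have hmod : u.1.1 ≡ v.1.1 [MOD p + 1] := Fin.ext_iff.1 heq
    have hle : u.1.1 + (p + 1) ≤ v.1.1 := by
      have := Nat.le_of_dvd (by omega) ((Nat.modEq_iff_dvd' huv.le).1 hmod)
      omega
    have huniv : s = Finset.univ := by
      refine Finset.eq_univ_of_forall fun c => ?_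
      have hc := c.2
      obtain ⟨w, h₁, h₂, h₃⟩ : ∃ w, u.1.1 ≤ w ∧ w ≤ v.1.1 ∧ w % (p + 1) = c := by
        have h₀ : u.1.1 % (p + 1) < p + 1 := Nat.mod_lt _ (Nat.succ_pos p)
        have hd := Nat.div_add_mod u.1.1 (p + 1)
        rcases Nat.lt_or_ge c (u.1.1 % (p + 1)) with h | h
        · refine ⟨c + (p + 1) * (u.1.1 / (p + 1) + 1), ?_, ?_, ?_⟩
          · rw [mul_add]; omega
          · rw [mul_add]; omega
          · rw [Nat.add_mul_mod_self_left, Nat.mod_eq_of_lt hc]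
        · refine ⟨c + (p + 1) * (u.1.1 / (p + 1)), by omega, by omega, ?_⟩
          rw [Nat.add_mul_mod_self_left, Nat.mod_eq_of_lt hc]
      have := hw w h₁ h₂
      rwa [show Fin.ofNat (p + 1) w = c from Fin.ext h₃] at this
    rw [huniv, Finset.card_univ, Fintype.card_fin] at hs
    omega
  refine IsForestOrder.treeDepth_le (lt := lt) ⟨?_, fun u h => lt_irrefl _ h.1, ?_, ?_, ?_⟩
  · rintro u v w ⟨h₁, h₂⟩ ⟨h₃, h₄⟩
    refine ⟨h₁.trans h₃, fun x hx hx' => ?_⟩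
    rcases le_total x v.1.1 with h | h
    · exact h₂ x hx h
    · exact h₄ x h hx'
  · rintro x y z ⟨h₁, h₂⟩ ⟨h₃, h₄⟩
    rcases lt_trichotomy x.1.1 y.1.1 with h | h | h
    · exact .inl ⟨h, fun w hw hw' => h₂ w hw (hw'.trans h₃.le)⟩
    · exact .inr (.inr (Subtype.ext (Fin.ext h)))
    · exact .inr (.inl ⟨h, fun w hw hw' => h₄ w hw (hw'.trans h₁.le)⟩)
  · have hsucc : ∀ u v : {v : Fin n | Fin.ofNat (p + 1) v.1 ∈ s}, u.1.1 + 1 = v.1.1 → lt u v := by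
      refine fun u v h => ⟨by omega, fun w h₁ h₂ => ?_⟩
      obtain rfl | rfl : w = u.1.1 ∨ w = v.1.1 := by omega
      · exact u.2
      · exact v.2
    intro u v h
    rw [comap_adj, pathGraph_adj] at h
    exact h.imp (hsucc u v) (hsucc v u)
  · intro t ht
    refine Finset.card_le_card_of_injOn (fun v => Fin.ofNat (p + 1) v.1) (fun v _ => v.2) ?_
    intro u hu v hv huv
    rcases ht u hu v hv with h | h | h
    · exact h
    · exact absurd huv (hne _ _ h)
    · exact absurd huv.symm (hne _ _ h)

end SimpleGraph

theorem chiP_pathGraph_eq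
    (p : ℕ) (hp : 0 < p) :
    ∃ N : ℕ, ∀ n : ℕ, N ≤ n → (pathGraph n).chiP p = p + 1 := by
  refine ⟨2 ^ p, fun n hn => ?_⟩
  refine IsLeast.csInf_eq ⟨⟨fun v => Fin.ofNat (p + 1) v, ?_⟩, ?_⟩
  · rintro i hi s rfl
    exact treeDepth_induce_pathGraph_le s hi
  · rintro m ⟨c, hc⟩
    by_contra! hm
    have hle := hc m (by omega) Finset.univ (Finset.card_fin m)
    let f : pathGraph n →g (pathGraph n).induce {v | c v ∈ Finset.univ} :=
      ⟨fun v => ⟨v, Finset.mem_univ (c v)⟩, fun h => h⟩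
    have hf : Function.Injective f := fun u v h => congrArg Subtype.val h
    have hlt := lt_treeDepth_pathGraph ((Nat.pow_le_pow_right two_pos (by omega : m ≤ p)).trans hn)
    exact (hlt.trans_le (treeDepth_le_of_injective f hf)).not_ge hle
end
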